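/- Let m ≥ 1 and L ≥ 1 be integers, let f₁, …, f_L : ℝ^m → ℝ be real analytic functions on ℝ^m such that the constant function 1 together with f₁, …, f_L are linearly independent over ℝ in the vector space of functions from ℝ^m to ℝ, and let b₁², …, b_L² be reals with b_ℓ² ≥ 1 for all ℓ. For g ∈ ℝ^L, SNR > 0 and ℓ = 1, …, L, define the ℓ-th optimal weighted computation rate R_ℓ(g; SNR) := sup over all families a₁, …, a_ℓ ∈ ℤ^L that are linearly independent over ℝ of min_{1 ≤ i ≤ ℓ} (1/2)·log₂(SNR / σ²_eff(g, aᵢ, B; SNR)). Then for Lebesgue-almost every g̃ ∈ ℝ^m, the vector g := (f₁(g̃), …, f_L(g̃)) satisfies, for every ℓ ∈ {1, …, L}, R_ℓ(g; SNR) / ((1/2)·log₂(1 + SNR)) → 1/L as SNR → ∞. -/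

import Mathlib

open Finset MeasureTheory

/-- A chain of nonzero subspaces has at most `finrank` many members. -/
theorem card_le_finrank_of_isChain {E : Type*} [AddCommGroup E] [Module ℝ E]
    [FiniteDimensional ℝ E] (F : Finset (Submodule ℝ E))
    (hF : IsChain (· ≤ ·) (F : Set (Submodule ℝ E))) (hbot : ⊥ ∉ F) :
    F.card ≤ Module.finrank ℝ E := by
  have : F.card ≤ (Finset.Icc 1 (Module.finrank ℝ E)).card := by
    apply Finset.card_le_card_of_injOn (fun W : Submodule ℝ E => Module.finrank ℝ W)
    · intro W hW
      simp only [Finset.coe_Icc, Set.mem_Icc]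
      refine ⟨?_, Submodule.finrank_le W⟩
      rw [Nat.one_le_iff_ne_zero]
      intro h
      rw [Submodule.finrank_eq_zero] at h
      exact hbot (h ▸ hW)
    · intro W hW W' hW' h
      rcases hF.total hW hW' with h1 | h1
      · exact Submodule.eq_of_le_of_finrank_eq h1 h
      · exact (Submodule.eq_of_le_of_finrank_eq h1 h.symm).symm
  simpa using this

/-- A vector and a chain of subspaces: adjoining the vector to the largest member not containing
it yields a subspace compatible with the chain. -/
theorem exists_sup_span_isChain {E : Type*} [AddCommGroup E] [Module ℝ E]
    (F : Finset (Submodule ℝ E)) (hF : IsChain (· ≤ ·) (F : Set (Submodule ℝ E)))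
    (v : E) (hv : v ≠ 0) :
    ∃ W₀, (W₀ = ⊥ ∨ W₀ ∈ F) ∧ v ∉ W₀ ∧
      ∀ U ∈ F, U ≤ W₀ ⊔ Submodule.span ℝ {v} ∨ W₀ ⊔ Submodule.span ℝ {v} ≤ U := by
  classical
  have hne : (insert ⊥ (F.filter fun W => v ∉ W)).Nonempty := ⟨⊥, by simp⟩
  obtain ⟨W₀, hW₀, hmax⟩ := Finset.exists_maximal hne
  have hW₀' : (W₀ = ⊥ ∨ W₀ ∈ F) ∧ v ∉ W₀ := by
    simp only [Finset.mem_insert, Finset.mem_filter] at hW₀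
    rcases hW₀ with rfl | ⟨h1, h2⟩
    · exact ⟨Or.inl rfl, by simpa using hv⟩
    · exact ⟨Or.inr h1, h2⟩
  refine ⟨W₀, hW₀'.1, hW₀'.2, fun U hU => ?_⟩
  have htot : U ≤ W₀ ∨ W₀ ≤ U := by
    rcases hW₀'.1 with h | h
    · right; simp [h]
    · exact hF.total hU h
  by_cases hvU : v ∈ U
  · right
    refine sup_le ?_ (by simpa using hvU)
    rcases htot with h | h
    · exact absurd (h hvU) hW₀'.2
    · exact h
  · left
    refine le_trans ?_ le_sup_left
    rcases htot with h | h
    · exact h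
    · exact hmax (by simp [hU, hvU]) h

/-- The constants in the nondivergence estimate, by remaining length of the flag. -/
noncomputable def nondivConst (c : ℝ) : ℕ → ℝ
  | 0 => 0
  | n + 1 => 15 * (nondivConst c n + c)

theorem nondivConst_nonneg {c : ℝ} (hc : 0 ≤ c) (n : ℕ) : 0 ≤ nondivConst c n := by
  induction n with
  | zero => simp [nondivConst]
  | succ n ih => simp only [nondivConst]; positivity

/-- If an interval set has the property that around each of its points there is a radius, such
that on the fivefold enlarged interval the set has relative measure at most `K`, then it has
measure at most `15 K` relative to the interval. -/
theorem volume_le_of_local {a b K : ℝ} (hK : 0 ≤ K) (S : Set ℝ)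
    (hS : S ⊆ Set.Icc a b) (r : ℝ → ℝ) (hr : ∀ x ∈ S, 0 < r x) (hr' : ∀ x ∈ S, r x ≤ b - a)
    (h : ∀ x ∈ S, volume (S ∩ Metric.closedBall x (5 * r x)) ≤ ENNReal.ofReal (K * (10 * r x))) :
    volume S ≤ ENNReal.ofReal (15 * K * (b - a)) := by
  obtain ⟨u, huS, hdisj, hcov⟩ :=
    Vitali.exists_disjoint_subfamily_covering_enlargement_closedBall S (fun x => x) r (b - a)
      hr' 5 (by norm_num)
  have hcount : u.Countable := by
    apply hdisj.countable_of_nonempty_interior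
    intro x hx
    exact ⟨x, Metric.ball_subset_interior_closedBall (Metric.mem_ball_self (hr x (huS hx)))⟩
  have hsub : S ⊆ ⋃ x ∈ u, S ∩ Metric.closedBall x (5 * r x) := by
    intro x hx
    obtain ⟨y, hy, hxy⟩ := hcov x hx
    simp only [Set.mem_iUnion]
    exact ⟨y, hy, hx, hxy (Metric.mem_closedBall_self (hr x hx).le)⟩
  rcases lt_or_ge b a with hba | hab
  · have : S = ∅ := by
      rw [Set.Icc_eq_empty (by linarith)] at hS
      exact Set.subset_empty_iff.mp hS
    simp [this]
  calc volume S ≤ volume (⋃ x ∈ u, S ∩ Metric.closedBall x (5 * r x)) := measure_mono hsub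
    _ ≤ ∑' x : u, volume (S ∩ Metric.closedBall (x : ℝ) (5 * r x)) := measure_biUnion_le _ hcount _
    _ ≤ ∑' x : u, ENNReal.ofReal (5 * K) * volume (Metric.closedBall (x : ℝ) (r x)) := by
        refine ENNReal.tsum_le_tsum fun x => ?_
        refine (h x (huS x.2)).trans ?_
        rw [Real.volume_closedBall, ← ENNReal.ofReal_mul (by positivity)]
        apply le_of_eq; congr 1; ring
    _ = ENNReal.ofReal (5 * K) * volume (⋃ x ∈ u, Metric.closedBall (x : ℝ) (r x)) := by
        rw [ENNReal.tsum_mul_left, measure_biUnion hcount hdisj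
          (fun x _ => measurableSet_closedBall)]
    _ ≤ ENNReal.ofReal (5 * K) * volume (Set.Icc (a - (b - a)) (b + (b - a))) := by
        gcongr
        refine Set.iUnion₂_subset fun x hx y hy => ?_
        have h1 := hS (huS hx)
        have h2 := hr' x (huS hx)
        rw [Metric.mem_closedBall, Real.dist_eq, abs_le] at hy
        exact ⟨by linarith [h1.1], by linarith [h1.2]⟩
    _ = ENNReal.ofReal (15 * K * (b - a)) := by
        rw [Real.volume_Icc, ← ENNReal.ofReal_mul (by positivity)]
        congr 1; ring

/-- One-dimensional quantitative nondivergence, in terms of an abstract covolume function `ψ`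
on a family `R` of subspaces. -/
theorem nondivergence_flag {E : Type*} [AddCommGroup E] [Module ℝ E] [FiniteDimensional ℝ E]
    (R : Set (Submodule ℝ E)) (Z : Set E) (N : E → ℝ → ℝ) (ψ : Submodule ℝ E → ℝ → ℝ)
    (A B C α ρ ε : ℝ) (hZ : ∀ v ∈ Z, v ≠ 0)
    (hR0 : ⊥ ∈ R) (hR : ∀ W ∈ R, ∀ v ∈ Z, W ⊔ Submodule.span ℝ {v} ∈ R)
    (hψ0 : ∀ x, ψ ⊥ x = 1) (hN : ∀ v ∈ Z, ∀ x ∈ Set.Icc A B, 0 ≤ N v x)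
    (hsub : ∀ W ∈ R, ∀ v ∈ Z, v ∉ W → ∀ x ∈ Set.Icc A B,
      ψ (W ⊔ Submodule.span ℝ {v}) x ≤ ψ W x * N v x)
    (hcont : ∀ W ∈ R, Continuous (ψ W))
    (hC : 0 ≤ C)
    (hgood : ∀ W ∈ R, W ≠ ⊥ → ∀ a b : ℝ, a ≤ b → A ≤ a → b ≤ B → ∀ M e : ℝ, 0 < M → 0 < e →
      (∃ y ∈ Set.Icc a b, M ≤ ψ W y) →
      volume {y ∈ Set.Icc a b | ψ W y < e * M} ≤ ENNReal.ofReal (C * e ^ α * (b - a)))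
    (hρ0 : 0 < ρ) (hρ : C * ρ ^ α < 1 / 5) (hε0 : 0 < ε) (hε : ε ≤ ρ) (n : ℕ) :
    ∀ (F : Finset (Submodule ℝ E)) (a b : ℝ), A ≤ a → b ≤ B →
      (F : Set (Submodule ℝ E)) ⊆ R → ⊥ ∉ F → IsChain (· ≤ ·) (F : Set (Submodule ℝ E)) →
      F.card + n = Module.finrank ℝ E + 1 →
      (∀ W ∈ F, ∀ x ∈ Set.Icc a b, ψ W x ≤ 1) →
      (∀ W ∈ R, W ≠ ⊥ → W ∉ F → (∀ U ∈ F, U ≤ W ∨ W ≤ U) → ∃ y ∈ Set.Icc a b, ρ ≤ ψ W y) →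
      volume {x ∈ Set.Icc a b | (∃ v ∈ Z, N v x < ε) ∧ ∀ W ∈ F, ε ≤ ψ W x} ≤
        ENNReal.ofReal (nondivConst (C / ρ ^ α) n * ε ^ α * (b - a)) := by
  classical
  induction n with
  | zero =>
    intro F a b _ _ _ hbot hchain hcard
    have := card_le_finrank_of_isChain F hchain hbot
    omega
  | succ n ih =>
    intro F a b hAa hbB hFR hbot hchain hcard hF1 hFρ
    set S := {x ∈ Set.Icc a b | (∃ v ∈ Z, N v x < ε) ∧ ∀ W ∈ F, ε ≤ ψ W x} with hSdef
    set K := nondivConst (C / ρ ^ α) n with hKdef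
    have hρα : 0 < ρ ^ α := Real.rpow_pos_of_pos hρ0 _
    have hεα : 0 < ε ^ α := Real.rpow_pos_of_pos hε0 _
    have hK0 : 0 ≤ K := nondivConst_nonneg (by positivity) n
    -- radii at which some compatible subspace stays small
    let comp : Submodule ℝ E → Prop := fun W =>
      W ∈ R ∧ W ≠ ⊥ ∧ W ∉ F ∧ ∀ U ∈ F, U ≤ W ∨ W ≤ U
    let T : ℝ → Set ℝ := fun x => {r | 0 < r ∧ ∃ W, comp W ∧
      ∀ y ∈ Set.Icc a b, |y - x| ≤ r → ψ W y < ρ}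
    have hTne : ∀ x ∈ S, (T x).Nonempty := by
      rintro x ⟨hx, ⟨v, hvZ, hv⟩, hxF⟩
      have hxAB : x ∈ Set.Icc A B := ⟨hAa.trans hx.1, hx.2.trans hbB⟩
      obtain ⟨W₀, hW₀, hvW₀, hW₀c⟩ := exists_sup_span_isChain F hchain v (hZ v hvZ)
      have hW₀R : W₀ ∈ R := by
        rcases hW₀ with rfl | h
        · exact hR0
        · exact hFR h
      have hψW₀ : ψ W₀ x ≤ 1 := by
        rcases hW₀ with rfl | h
        · exact (hψ0 x).le
        · exact hF1 _ h x hx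
      set W := W₀ ⊔ Submodule.span ℝ {v} with hW
      have hψW : ψ W x < ε := by
        have h1 := hsub W₀ hW₀R v hvZ hvW₀ x hxAB
        have h2 := hN v hvZ x hxAB
        nlinarith
      have hWR : W ∈ R := hR W₀ hW₀R v hvZ
      have hcW : comp W := by
        refine ⟨hWR, ?_, ?_, hW₀c⟩
        · intro h
          have : v ∈ W := Submodule.mem_sup_right (Submodule.mem_span_singleton_self v)
          rw [h] at this
          exact hZ v hvZ (by simpa using this)
        · intro h
          exact absurd (hxF W h) (not_le.mpr hψW)
      have : ∀ᶠ y in nhds x, ψ W y < ρ :=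
        (hcont W hWR).continuousAt.eventually_lt continuousAt_const (hψW.trans_le hε)
      obtain ⟨r, hr, hr'⟩ := Metric.eventually_nhds_iff.mp this
      refine ⟨r / 2, by positivity, W, hcW, fun y _ hy => hr' ?_⟩
      rw [Real.dist_eq]; linarith
    have hTbdd : ∀ x ∈ S, ∀ r ∈ T x, r < b - a := by
      rintro x ⟨hx, -⟩ r ⟨hr, W, hW, hWr⟩
      by_contra! hlt
      obtain ⟨y, hy, hy'⟩ := hFρ W hW.1 hW.2.1 hW.2.2.1 hW.2.2.2
      have := hWr y hy (by rw [abs_le]; constructor <;> linarith [hx.1, hx.2, hy.1, hy.2])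
      linarith
    have hrad : ∀ x ∈ S, ∃ r ∈ T x, ∀ r' , 2 * r ≤ r' → r' ∉ T x := by
      intro x hx
      have hb : BddAbove (T x) := ⟨b - a, fun r hr => (hTbdd x hx r hr).le⟩
      obtain ⟨r0, hr0⟩ := hTne x hx
      have hpos : 0 < sSup (T x) := lt_of_lt_of_le hr0.1 (le_csSup hb hr0)
      obtain ⟨r, hr, hr2⟩ := exists_lt_of_lt_csSup (hTne x hx) (half_lt_self hpos)
      refine ⟨r, hr, fun r' hr' h' => ?_⟩
      have := le_csSup hb h'
      linarith
    choose! r hrT hr2 using hrad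
    have key : volume S ≤ ENNReal.ofReal (15 * ((K + C / ρ ^ α) * ε ^ α) * (b - a)) := by
      apply volume_le_of_local (by positivity) S (fun x hx => hx.1) r (fun x hx => (hrT x hx).1)
        (fun x hx => (hTbdd x hx _ (hrT x hx)).le)
      intro x hx
      obtain ⟨hr0, W, hW, hWr⟩ := hrT x hx
      have hxI := hx.1
      set a' := max a (x - 5 * r x) with ha'
      set b' := min b (x + 5 * r x) with hb'
      have hab' : a' ≤ b' := by
        apply max_le <;> apply le_min <;> linarith [hxI.1, hxI.2]
      have hlen : b' - a' ≤ 10 * r x := by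
        have := le_max_right a (x - 5 * r x)
        have := min_le_right b (x + 5 * r x)
        linarith
      have hmem : ∀ y, y ∈ Set.Icc a' b' ↔ y ∈ Set.Icc a b ∧ |y - x| ≤ 5 * r x := by
        intro y
        simp only [Set.mem_Icc, ha', hb', max_le_iff, le_min_iff, abs_le]
        constructor
        · rintro ⟨⟨h1, h2⟩, h3, h4⟩
          exact ⟨⟨h1, h3⟩, by linarith, by linarith⟩
        · rintro ⟨⟨h1, h2⟩, h3, h4⟩
          exact ⟨⟨h1, by linarith⟩, h2, by linarith⟩
      have hlarge : ∀ U, comp U → ∃ y ∈ Set.Icc a' b', ρ ≤ ψ U y := by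
        intro U hU
        have h1 := hr2 x hx (2 * r x) le_rfl
        by_contra! hcon
        refine h1 ⟨by linarith, U, hU, fun y hy hyx => hcon y ?_⟩
        exact (hmem y).mpr ⟨hy, by linarith⟩
      have hAa' : A ≤ a' := hAa.trans (le_max_left _ _)
      have hbB' : b' ≤ B := (min_le_left _ _).trans hbB
      -- doubling: the chosen subspace stays bounded on the enlarged interval
      have hW1 : ∀ y ∈ Set.Icc a' b', ψ W y ≤ 1 := by
        intro y hy
        by_contra! hlt
        have h1 := hgood W hW.1 hW.2.1 a' b' hab' hAa' hbB' 1 ρ one_pos hρ0 ⟨y, hy, hlt.le⟩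
        have h2 : Set.Icc (max a (x - r x)) (min b (x + r x)) ⊆
            {y ∈ Set.Icc a' b' | ψ W y < ρ * 1} := by
          rintro z ⟨hz1, hz2⟩
          rw [max_le_iff] at hz1
          rw [le_min_iff] at hz2
          have hzab : z ∈ Set.Icc a b := ⟨hz1.1, hz2.1⟩
          have hzx : |z - x| ≤ r x := by rw [abs_le]; constructor <;> linarith
          refine ⟨(hmem z).mpr ⟨hzab, by linarith⟩, ?_⟩
          rw [mul_one]
          exact hWr z hzab hzx
        have h3 := (measure_mono h2).trans h1
        rw [Real.volume_Icc] at h3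
        have hpos : 0 < b' - a' := by
          obtain ⟨z, hz, hz'⟩ := hlarge W hW
          have := (hmem z).mp hz
          have h4 := hWr z this.1
          have hne : z ≠ x := by
            rintro rfl
            have := h4 (by simpa using hr0.le)
            linarith
          have hx' : x ∈ Set.Icc a' b' := (hmem x).mpr ⟨hxI, by simpa using hr0.le⟩
          rcases lt_or_gt_of_ne hne with h | h
          · linarith [hz.1, hx'.2]
          · linarith [hz.2, hx'.1]
        rw [ENNReal.ofReal_le_ofReal_iff (by positivity)] at h3
        have h5 : b' - a' ≤ 5 * (min b (x + r x) - max a (x - r x)) := by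
          rcases max_cases a (x - 5 * r x) with h | h <;>
          rcases min_cases b (x + 5 * r x) with h' | h' <;>
          rcases max_cases a (x - r x) with h'' | h'' <;>
          rcases min_cases b (x + r x) with hmin | hmin <;>
          linarith [hxI.1, hxI.2]
        nlinarith
      -- apply the induction hypothesis to the extended flag
      have hF' : volume {y ∈ Set.Icc a' b' | (∃ v ∈ Z, N v y < ε) ∧ ∀ U ∈ insert W F, ε ≤ ψ U y} ≤
          ENNReal.ofReal (K * ε ^ α * (b' - a')) := by
        apply ih (insert W F) a' b' hAa' hbB'
        · intro U hU
          rw [Finset.coe_insert] at hU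
          rcases hU with rfl | hU
          · exact hW.1
          · exact hFR hU
        · rw [Finset.mem_insert, not_or]
          exact ⟨hW.2.1.symm, hbot⟩
        · rw [Finset.coe_insert]
          apply hchain.insert
          intro U hU _
          exact (hW.2.2.2 U hU).symm
        · rw [Finset.card_insert_of_notMem hW.2.2.1]; omega
        · intro U hU y hy
          rcases Finset.mem_insert.mp hU with rfl | hU
          · exact hW1 y hy
          · exact hF1 U hU y ((hmem y).mp hy).1
        · intro U hUR hU0 hUF hUc
          refine hlarge U ⟨hUR, hU0, fun h => hUF (Finset.mem_insert_of_mem h), fun V hV => ?_⟩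
          exact hUc V (Finset.mem_insert_of_mem hV)
      have hW' := hgood W hW.1 hW.2.1 a' b' hab' hAa' hbB' ρ (ε / ρ) hρ0 (by positivity)
        (hlarge W hW)
      rw [div_mul_cancel₀ _ hρ0.ne', Real.div_rpow hε0.le hρ0.le] at hW'
      have hcover : S ∩ Metric.closedBall x (5 * r x) ⊆
          {y ∈ Set.Icc a' b' | (∃ v ∈ Z, N v y < ε) ∧ ∀ U ∈ insert W F, ε ≤ ψ U y} ∪
          {y ∈ Set.Icc a' b' | ψ W y < ε} := by
        rintro y ⟨hyS, hy⟩
        rw [Metric.mem_closedBall, Real.dist_eq] at hy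
        have hyI := (hmem y).mpr ⟨hyS.1, hy⟩
        by_cases hlt : ψ W y < ε
        · exact Or.inr ⟨hyI, hlt⟩
        · left
          refine ⟨hyI, hyS.2.1, fun U hU => ?_⟩
          rcases Finset.mem_insert.mp hU with rfl | hU
          · exact not_lt.mp hlt
          · exact hyS.2.2 U hU
      calc volume (S ∩ Metric.closedBall x (5 * r x))
          ≤ _ := (measure_mono hcover).trans (measure_union_le _ _)
        _ ≤ ENNReal.ofReal (K * ε ^ α * (b' - a')) +
            ENNReal.ofReal (C * (ε ^ α / ρ ^ α) * (b' - a')) := add_le_add hF' hW'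
        _ = ENNReal.ofReal ((K + C / ρ ^ α) * ε ^ α * (b' - a')) := by
            have : 0 ≤ b' - a' := by linarith
            rw [← ENNReal.ofReal_add (by positivity) (by positivity)]
            congr 1; ring
        _ ≤ ENNReal.ofReal ((K + C / ρ ^ α) * ε ^ α * (10 * r x)) := by
            gcongr
    refine key.trans (le_of_eq ?_)
    congr 1
    simp only [nondivConst]
    ring

section GoodFunctions

open scoped ContDiff

/-- A set of large measure contains many well-separated points. -/
theorem exists_separated_points {s : ℝ} (hs : 0 ≤ s) (N : ℕ) :
    ∀ E : Set ℝ, BddBelow E → ENNReal.ofReal (N * s) < volume E →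
      ∃ t : ℕ → ℝ, (∀ i < N, t i ∈ E) ∧ ∀ i j, i < j → j < N → t i + s ≤ t j := by
  induction N with
  | zero => intro E _ _; exact ⟨fun _ => 0, by simp, by simp⟩
  | succ N ih =>
    intro E hE hvol
    have hne : E.Nonempty := by
      rw [Set.nonempty_iff_ne_empty]
      rintro rfl
      simp at hvol
    obtain ⟨δ, hδ, hδ'⟩ : ∃ δ > 0, ENNReal.ofReal (N * s + s + δ) < volume E := by
      obtain ⟨c, hc1, hc2⟩ := exists_between hvol
      have hc : c ≠ ⊤ := (hc2.trans_le le_top).ne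
      rw [ENNReal.ofReal_lt_iff_lt_toReal (by positivity) hc] at hc1
      refine ⟨c.toReal - (N * s + s), by push_cast at hc1; linarith, ?_⟩
      rwa [add_sub_cancel, ENNReal.ofReal_toReal hc]
    obtain ⟨x₀, hx₀, hx₀'⟩ := exists_lt_of_csInf_lt hne (lt_add_of_pos_right (sInf E) hδ)
    have hcov : E ⊆ Set.Icc (sInf E) (x₀ + s) ∪ (E ∩ Set.Ici (x₀ + s)) := by
      intro y hy
      rcases le_total y (x₀ + s) with h | h
      · exact Or.inl ⟨csInf_le hE hy, h⟩
      · exact Or.inr ⟨hy, h⟩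
    have hvol' : ENNReal.ofReal (N * s) < volume (E ∩ Set.Ici (x₀ + s)) := by
      by_contra! hle
      have h1 := (measure_mono hcov).trans (measure_union_le (μ := volume) _ _)
      rw [Real.volume_Icc] at h1
      have h2 : volume E ≤ ENNReal.ofReal (N * s + s + δ) := by
        refine h1.trans ((add_le_add_right hle _).trans ?_)
        have : sInf E ≤ x₀ := csInf_le hE hx₀
        rw [← ENNReal.ofReal_add (by linarith) (by positivity)]
        apply ENNReal.ofReal_le_ofReal
        linarith
      exact absurd hδ' (not_lt.mpr h2)
    obtain ⟨t, ht1, ht2⟩ := ih _ (hE.mono Set.inter_subset_left) hvol'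
    refine ⟨fun i => Nat.casesOn i x₀ t, ?_, ?_⟩
    · rintro (_ | i) hi
      · exact hx₀
      · exact (ht1 i (by omega)).1
    · rintro (_ | i) (_ | j) hij hj
      · omega
      · exact (ht1 j (by omega)).2
      · omega
      · exact ht2 i j (by omega) (by omega)

/-- Propagation of smallness from separated points: if a high derivative has bounded ratio on an
interval, a function small at many separated points is small on the whole interval. -/
theorem abs_le_of_separated_points {a b s C : ℝ} (hs : 0 < s) (hsb : s ≤ 2 * (b - a)) (hC : 0 ≤ C)
    (k : ℕ) :
    ∀ (h : ℝ → ℝ) (ε : ℝ) (t : ℕ → ℝ), 0 ≤ ε → ContDiff ℝ ∞ h →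
      (∀ y ∈ Set.Icc a b, ∀ z ∈ Set.Icc a b, |iteratedDeriv k h y| ≤ C * |iteratedDeriv k h z|) →
      (∀ i < 2 ^ k, t i ∈ Set.Icc a b) → (∀ i j, i < j → j < 2 ^ k → t i + s ≤ t j) →
      (∀ i < 2 ^ k, |h (t i)| ≤ ε) →
      ∀ y ∈ Set.Icc a b, |h y| ≤ (k + C) * ε * (2 * (b - a) / s) ^ k := by
  induction k with
  | zero =>
    intro h ε t hε hh hC' ht hts hth y hy
    have h1 := hC' y hy (t 0) (ht 0 (by simp))
    have h2 := hth 0 (by simp)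
    simp only [iteratedDeriv_zero] at h1
    simp only [CharP.cast_eq_zero, zero_add, pow_zero, mul_one]
    exact h1.trans (mul_le_mul_of_nonneg_left h2 hC)
  | succ k ih =>
    intro h ε t hε hh hC' ht hts hth y hy
    have hd : Differentiable ℝ h := hh.differentiable (by simp)
    have hex : ∀ i < 2 ^ k, ∃ ξ, t (2 * i) < ξ ∧ ξ < t (2 * i + 1) ∧ |deriv h ξ| ≤ 2 * ε / s := by
      intro i hi
      have hi1 : 2 * i + 1 < 2 ^ (k + 1) := by rw [pow_succ]; omega
      have hlt := hts (2 * i) (2 * i + 1) (by omega) hi1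
      obtain ⟨ξ, hξ, hξ'⟩ := exists_deriv_eq_slope h (show t (2 * i) < t (2 * i + 1) by linarith)
        hd.continuous.continuousOn hd.differentiableOn
      refine ⟨ξ, hξ.1, hξ.2, ?_⟩
      have h1 := hth (2 * i) (by omega)
      have h2 := hth (2 * i + 1) hi1
      rw [hξ', abs_div, abs_of_pos (show 0 < t (2 * i + 1) - t (2 * i) by linarith)]
      apply div_le_div₀ (by positivity) _ hs (by linarith)
      exact (abs_sub _ _).trans (by linarith)
    choose! ξ hξ1 hξ2 hξ3 using hex
    have hmem : ∀ i < 2 ^ k, ξ i ∈ Set.Icc a b := by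
      intro i hi
      have hi1 : 2 * i + 1 < 2 ^ (k + 1) := by rw [pow_succ]; omega
      exact ⟨(ht (2 * i) (by omega)).1.trans (hξ1 i hi).le, (hξ2 i hi).le.trans (ht _ hi1).2⟩
    have hh' : ContDiff ℝ ∞ (deriv h) := by
      have := (contDiff_infty_iff_deriv (f := h)).mp hh
      exact this.2
    have key := ih (deriv h) (2 * ε / s) ξ (by positivity) hh'
      (by simpa only [iteratedDeriv_succ'] using hC') hmem
      (by
        intro i j hij hj
        have hj1 : 2 * j + 1 < 2 ^ (k + 1) := by rw [pow_succ]; omega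
        have := hts (2 * i + 1) (2 * j) (by omega) (by omega)
        linarith [hξ2 i (by omega), hξ1 j hj]) hξ3
    have h0 := ht 0 (by positivity)
    have hmv : |h y - h (t 0)| ≤ (k + C) * (2 * ε / s) * (2 * (b - a) / s) ^ k * |y - t 0| := by
      have := (convex_Icc a b).norm_image_sub_le_of_norm_deriv_le (f := h)
        (fun x _ => hd x) (fun x hx => by simpa using key x hx) h0 hy
      simpa using this
    have hab : 0 ≤ b - a := by linarith
    have hlen : |y - t 0| ≤ b - a := by
      rw [abs_le]; constructor <;> linarith [hy.1, hy.2, h0.1, h0.2]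
    have hq : 1 ≤ 2 * (b - a) / s := by rwa [le_div_iff₀ hs, one_mul]
    have hq' : 1 ≤ (2 * (b - a) / s) ^ (k + 1) := one_le_pow₀ hq
    have h3 : |h y| ≤ ε + (k + C) * (2 * ε / s) * (2 * (b - a) / s) ^ k * (b - a) := by
      have h4 : |h y| ≤ |h (t 0)| + |h y - h (t 0)| := by
        have := abs_add_le (h (t 0)) (h y - h (t 0))
        rwa [add_sub_cancel] at this
      have h5 := hth 0 (by positivity)
      have h6 : (k + C) * (2 * ε / s) * (2 * (b - a) / s) ^ k * |y - t 0| ≤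
        (k + C) * (2 * ε / s) * (2 * (b - a) / s) ^ k * (b - a) := by gcongr
      linarith
    have h7 : (k + C) * (2 * ε / s) * (2 * (b - a) / s) ^ k * (b - a) =
      (k + C) * ε * (2 * (b - a) / s) ^ (k + 1) := by
      rw [pow_succ]; ring
    rw [h7] at h3
    push_cast
    nlinarith

/-- A function, some derivative of which has bounded ratio on an interval, is good there. -/
theorem volume_sublevel_le {a b C M e : ℝ} {d k : ℕ} (hd : 1 ≤ d) (hk : k ≤ d) (hab : a ≤ b)
    (hC : 1 ≤ C) (h : ℝ → ℝ) (hh : ContDiff ℝ ∞ h)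
    (hC' : ∀ y ∈ Set.Icc a b, ∀ z ∈ Set.Icc a b,
      |iteratedDeriv k h y| ≤ C * |iteratedDeriv k h z|)
    (hM : 0 < M) (he : 0 < e) (hy : ∃ y ∈ Set.Icc a b, M ≤ |h y|) :
    volume {y ∈ Set.Icc a b | |h y| < e * M} ≤
      ENNReal.ofReal (2 ^ (d + 1) * (2 * (d + C)) ^ (1 / d : ℝ) * e ^ (1 / d : ℝ) * (b - a)) := by
  set θ := (2 * (d + C)) ^ (1 / d : ℝ) * e ^ (1 / d : ℝ) with hθ
  have hd0 : (0 : ℝ) < d := by exact_mod_cast hd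
  have hθ0 : 0 < θ := by positivity
  have hθd : θ ^ d = 2 * (d + C) * e := by
    rw [hθ, mul_pow, ← Real.rpow_natCast, ← Real.rpow_natCast, ← Real.rpow_mul (by positivity),
      ← Real.rpow_mul he.le, one_div, inv_mul_cancel₀ hd0.ne', Real.rpow_one, Real.rpow_one]
  set E := {y ∈ Set.Icc a b | |h y| < e * M} with hE
  have hEsub : E ⊆ Set.Icc a b := fun y hy => hy.1
  have h2d : (1 : ℝ) ≤ 2 ^ d := one_le_pow₀ (by norm_num)
  rcases lt_or_ge 1 θ with h1 | h1
  · refine (measure_mono hEsub).trans ?_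
    rw [Real.volume_Icc]
    apply ENNReal.ofReal_le_ofReal
    have : 1 ≤ 2 ^ (d + 1) * θ := by rw [pow_succ]; nlinarith
    nlinarith
  by_contra! hlt
  rcases hab.eq_or_lt with rfl | hab
  · have := (measure_mono hEsub).trans_eq (Real.volume_Icc (a := a) (b := a))
    simp only [sub_self, mul_zero, ENNReal.ofReal_zero] at hlt this
    exact absurd hlt (not_lt.mpr this)
  have hba : 0 < b - a := by linarith
  set s := 2 * (b - a) * θ with hs
  have hs0 : 0 < s := by positivity
  have hvol : ENNReal.ofReal (((2 ^ k : ℕ) : ℝ) * s) < volume E := by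
    refine lt_of_le_of_lt (ENNReal.ofReal_le_ofReal ?_) hlt
    have : (2 : ℝ) ^ k ≤ 2 ^ d := pow_le_pow_right₀ (by norm_num) hk
    push_cast
    rw [hs, pow_succ, show (2 : ℝ) ^ d * 2 * (2 * (d + C)) ^ (1 / d : ℝ) * e ^ (1 / d : ℝ) * (b - a)
      = 2 ^ d * (2 * (b - a) * θ) by rw [hθ]; ring]
    gcongr
  obtain ⟨t, ht1, ht2⟩ := exists_separated_points hs0.le (2 ^ k) E
    (bddBelow_Icc.mono hEsub) hvol
  obtain ⟨y, hyI, hyM⟩ := hy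
  have hsb : s ≤ 2 * (b - a) := by rw [hs]; nlinarith
  have key := abs_le_of_separated_points hs0 hsb (by linarith) k h (e * M) t (by positivity) hh hC'
    (fun i hi => (ht1 i hi).1) ht2 (fun i hi => (ht1 i hi).2.le) y hyI
  have hq : 2 * (b - a) / s = θ⁻¹ := by rw [hs]; field_simp
  rw [hq] at key
  have hθ1 : 1 ≤ θ⁻¹ := (one_le_inv₀ hθ0).mpr h1
  have h3 : (θ⁻¹) ^ k ≤ (θ⁻¹) ^ d := pow_le_pow_right₀ hθ1 hk
  have h4 : ((k : ℝ) + C) ≤ d + C := by gcongr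
  have h5 : (k + C) * (e * M) * θ⁻¹ ^ k ≤ (d + C) * (e * M) * θ⁻¹ ^ d := by
    gcongr
  have h6 : (d + C) * (e * M) * θ⁻¹ ^ d = M / 2 := by
    rw [inv_pow, hθd]; field_simp
  linarith

/-- Near any point, every linear combination of finitely many linearly independent analytic
functions has a derivative of bounded order and bounded ratio. -/
theorem exists_iteratedDeriv_ratio_of_linearIndependent {n : ℕ} (φ : Fin n → ℝ → ℝ)
    (hφ : ∀ i, AnalyticOnNhd ℝ (φ i) Set.univ) (hli : LinearIndependent ℝ φ) (x₀ : ℝ) :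
    ∃ δ > 0, ∃ d : ℕ, ∀ u : Fin n → ℝ, ∃ k ≤ d,
      ∀ y ∈ Set.Icc (x₀ - δ) (x₀ + δ), ∀ z ∈ Set.Icc (x₀ - δ) (x₀ + δ),
        |iteratedDeriv k (∑ i, u i • φ i) y| ≤ 4 * |iteratedDeriv k (∑ i, u i • φ i) z| := by
  have hsm : ∀ i, ContDiff ℝ ∞ (φ i) := fun i => contDiff_iff_contDiffAt.mpr
    fun x => ((hφ i) x (Set.mem_univ x)).contDiffAt
  have hder : ∀ (k : ℕ) (u : Fin n → ℝ) (y : ℝ),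
      iteratedDeriv k (∑ i, u i • φ i) y = ∑ i, u i * iteratedDeriv k (φ i) y := by
    intro k u y
    rw [iteratedDeriv_sum]
    · refine Finset.sum_congr rfl fun i _ => ?_
      rw [iteratedDeriv_const_smul_field]
      rfl
    · intro i _
      exact ((hsm i).const_smul (u i)).contDiffAt.of_le (by exact_mod_cast le_top)
  have hcont : ∀ k : ℕ, Continuous fun p : (Fin n → ℝ) × ℝ =>
      |∑ i, p.1 i * iteratedDeriv k (φ i) p.2| := by
    intro k
    refine (continuous_finsetSum _ fun i _ => ?_).abs
    exact ((continuous_apply i).comp continuous_fst).mul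
      (((hsm i).continuous_iteratedDeriv k (by exact_mod_cast le_top)).comp continuous_snd)
  have hsphere : ∃ δ > 0, ∃ d : ℕ, ∀ u ∈ Metric.sphere (0 : Fin n → ℝ) 1, ∃ k ≤ d,
      ∀ y ∈ Set.Icc (x₀ - δ) (x₀ + δ), ∀ z ∈ Set.Icc (x₀ - δ) (x₀ + δ),
        |∑ i, u i * iteratedDeriv k (φ i) y| ≤ 4 * |∑ i, u i * iteratedDeriv k (φ i) z| := by
    refine IsCompact.induction_on (isCompact_sphere (0 : Fin n → ℝ) 1)
      (p := fun s => ∃ δ > 0, ∃ d : ℕ, ∀ u ∈ s, ∃ k ≤ d,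
        ∀ y ∈ Set.Icc (x₀ - δ) (x₀ + δ), ∀ z ∈ Set.Icc (x₀ - δ) (x₀ + δ),
          |∑ i, u i * iteratedDeriv k (φ i) y| ≤ 4 * |∑ i, u i * iteratedDeriv k (φ i) z|)
      ?_ ?_ ?_ ?_
    · exact ⟨1, one_pos, 0, by simp⟩
    · rintro s t hst ⟨δ, hδ, d, h⟩
      exact ⟨δ, hδ, d, fun u hu => h u (hst hu)⟩
    · rintro s t ⟨δ, hδ, d, h⟩ ⟨δ', hδ', d', h'⟩
      have h1 : Set.Icc (x₀ - min δ δ') (x₀ + min δ δ') ⊆ Set.Icc (x₀ - δ) (x₀ + δ) :=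
        Set.Icc_subset_Icc (by linarith [min_le_left δ δ']) (by linarith [min_le_left δ δ'])
      have h2 : Set.Icc (x₀ - min δ δ') (x₀ + min δ δ') ⊆ Set.Icc (x₀ - δ') (x₀ + δ') :=
        Set.Icc_subset_Icc (by linarith [min_le_right δ δ']) (by linarith [min_le_right δ δ'])
      refine ⟨min δ δ', lt_min hδ hδ', max d d', ?_⟩
      rintro u (hu | hu)
      · obtain ⟨k, hk, hk'⟩ := h u hu
        exact ⟨k, hk.trans (le_max_left _ _), fun y hy z hz => hk' y (h1 hy) z (h1 hz)⟩
      · obtain ⟨k, hk, hk'⟩ := h' u hu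
        exact ⟨k, hk.trans (le_max_right _ _), fun y hy z hz => hk' y (h2 hy) z (h2 hz)⟩
    · intro u hu
      obtain ⟨k, hk⟩ : ∃ k, iteratedDeriv k (∑ i, u i • φ i) x₀ ≠ 0 := by
        by_contra! hzero
        have han : AnalyticOnNhd ℝ (∑ i, u i • φ i) Set.univ := by
          apply Finset.analyticOnNhd_sum
          intro i _
          exact (analyticOnNhd_const (v := u i)).smul (hφ i)
        have htop : analyticOrderAt (∑ i, u i • φ i) x₀ = ⊤ := by
          rw [ENat.eq_top_iff_forall_ge]
          intro m
          rw [natCast_le_analyticOrderAt_iff_iteratedDeriv_eq_zero (han x₀ (Set.mem_univ _))]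
          exact fun i _ => hzero i
        rw [analyticOrderAt_eq_top] at htop
        have hz := han.eqOn_zero_of_preconnected_of_eventuallyEq_zero isPreconnected_univ
          (Set.mem_univ x₀) htop
        have hz' : ∑ i, u i • φ i = 0 := funext fun x => hz (Set.mem_univ x)
        have hu0 : u = 0 := funext fun i => (Fintype.linearIndependent_iff.mp hli) u hz' i
        rw [hu0] at hu
        simp at hu
      rw [hder] at hk
      set m := |∑ i, u i * iteratedDeriv k (φ i) x₀| with hm
      have hm0 : 0 < m := abs_pos.mpr hk
      have h1 : ∀ᶠ p in nhds (u, x₀), m / 2 < |∑ i, p.1 i * iteratedDeriv k (φ i) p.2| :=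
        continuousAt_const.eventually_lt (hcont k).continuousAt (by simp only; linarith)
      have h2 : ∀ᶠ p in nhds (u, x₀), |∑ i, p.1 i * iteratedDeriv k (φ i) p.2| < 2 * m :=
        (hcont k).continuousAt.eventually_lt continuousAt_const (by simp only; linarith)
      obtain ⟨r, hr, hr'⟩ := Metric.eventually_nhds_iff.mp (h1.and h2)
      refine ⟨Metric.ball u r, mem_nhdsWithin_of_mem_nhds (Metric.ball_mem_nhds u hr), r / 2,
        by positivity, k, fun w hw => ⟨k, le_rfl, fun y hy z hz => ?_⟩⟩
      have hmem : ∀ y ∈ Set.Icc (x₀ - r / 2) (x₀ + r / 2), dist (w, y) (u, x₀) < r := by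
        intro y hy
        rw [Prod.dist_eq, max_lt_iff]
        refine ⟨hw, ?_⟩
        rw [Real.dist_eq, abs_lt]
        constructor <;> linarith [hy.1, hy.2]
      have hy' := (hr' (hmem y hy)).2
      have hz' := (hr' (hmem z hz)).1
      simp only at hy' hz'
      linarith
  obtain ⟨δ, hδ, d, h⟩ := hsphere
  refine ⟨δ, hδ, d, fun u => ?_⟩
  simp only [hder]
  by_cases hu : u = 0
  · exact ⟨0, by simp, fun y _ z _ => by simp [hu]⟩
  · have hun : 0 < ‖u‖ := norm_pos_iff.mpr hu
    obtain ⟨k, hk, hk'⟩ := h (‖u‖⁻¹ • u) (by simp [norm_smul, hun.ne'])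
    refine ⟨k, hk, fun y hy z hz => ?_⟩
    have h3 := hk' y hy z hz
    have h4 : ∀ y, ∑ i, (‖u‖⁻¹ • u) i * iteratedDeriv k (φ i) y =
        ‖u‖⁻¹ * ∑ i, u i * iteratedDeriv k (φ i) y := by
      intro y
      rw [Finset.mul_sum]
      refine Finset.sum_congr rfl fun i _ => ?_
      simp only [Pi.smul_apply, smul_eq_mul]; ring
    rw [h4, h4, abs_mul, abs_mul, abs_of_pos (inv_pos.mpr hun)] at h3
    have h5 : 0 < ‖u‖⁻¹ := inv_pos.mpr hun
    nlinarith

/-- The linear span of finitely many analytic functions is uniformly good near any point. -/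
theorem exists_good_of_analytic {ι : Type*} [Finite ι] (φ : ι → ℝ → ℝ)
    (hφ : ∀ i, AnalyticOnNhd ℝ (φ i) Set.univ) (x₀ : ℝ) :
    ∃ δ > 0, ∃ C > (0 : ℝ), ∃ α > (0 : ℝ), ∀ h ∈ Submodule.span ℝ (Set.range φ), ∀ a b : ℝ, a ≤ b →
      x₀ - δ ≤ a → b ≤ x₀ + δ → ∀ M e : ℝ, 0 < M → 0 < e → (∃ y ∈ Set.Icc a b, M ≤ |h y|) →
      volume {y ∈ Set.Icc a b | |h y| < e * M} ≤ ENNReal.ofReal (C * e ^ α * (b - a)) := by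
  classical
  set V := Submodule.span ℝ (Set.range φ) with hV
  have : FiniteDimensional ℝ V := FiniteDimensional.span_of_finite ℝ (Set.finite_range φ)
  have hVan : ∀ h ∈ V, AnalyticOnNhd ℝ h Set.univ := by
    intro h hh
    induction hh using Submodule.span_induction with
    | mem x hx => obtain ⟨i, rfl⟩ := hx; exact hφ i
    | zero => exact analyticOnNhd_const
    | add f g _ _ hf hg => exact hf.add hg
    | smul c f _ hf => exact (analyticOnNhd_const (v := c)).smul hf
  let B := Module.finBasis ℝ V
  have hli : LinearIndependent ℝ fun i => (B i : ℝ → ℝ) :=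
    B.linearIndependent.map' V.subtype (Submodule.ker_subtype V)
  obtain ⟨δ, hδ, d, h⟩ := exists_iteratedDeriv_ratio_of_linearIndependent
    (fun i => (B i : ℝ → ℝ)) (fun i => hVan _ (B i).2) hli x₀
  refine ⟨δ, hδ, 2 ^ (d + 1 + 1) * (2 * (((d + 1 : ℕ) : ℝ) + 4)) ^ (1 / ((d + 1 : ℕ) : ℝ)), by positivity,
    1 / ((d + 1 : ℕ) : ℝ), by positivity, ?_⟩
  intro g hg a b hab ha hb M e hM he hy
  obtain ⟨k, hk, hk'⟩ := h (fun i => B.repr ⟨g, hg⟩ i)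
  have hsum : ∑ i, B.repr ⟨g, hg⟩ i • (B i : ℝ → ℝ) = g := by
    have := congrArg Subtype.val (B.sum_repr ⟨g, hg⟩)
    push_cast at this
    exact this
  rw [hsum] at hk'
  exact volume_sublevel_le (d := d + 1) (k := k) (by omega) (by omega) hab (by norm_num) g
    (contDiff_iff_contDiffAt.mpr fun x => (hVan g hg x (Set.mem_univ x)).contDiffAt)
    (fun y hy z hz => hk' y ⟨ha.trans hy.1, hy.2.trans hb⟩ z ⟨ha.trans hz.1, hz.2.trans hb⟩)
    hM he hy

end GoodFunctions

section GramDeterminants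

open Matrix

/-- The matrix of the quadratic form `v ↦ |v|² + s (|v|² |g|² - (v · g)²)`. -/
noncomputable def channelMatrix {L : ℕ} (s : ℝ) (g : Fin L → ℝ) : Matrix (Fin L) (Fin L) ℝ :=
  (1 + s * (g ⬝ᵥ g)) • (1 : Matrix (Fin L) (Fin L) ℝ) - s • vecMulVec g g

theorem dotProduct_channelMatrix_mulVec {L : ℕ} (s : ℝ) (g v w : Fin L → ℝ) :
    v ⬝ᵥ channelMatrix s g *ᵥ w = (1 + s * (g ⬝ᵥ g)) * (v ⬝ᵥ w) - s * ((v ⬝ᵥ g) * (g ⬝ᵥ w)) := by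
  simp only [channelMatrix, sub_mulVec, smul_mulVec, one_mulVec, vecMulVec_mulVec, dotProduct_sub,
    dotProduct_smul, smul_eq_mul, op_smul_eq_smul]
  ring

theorem dotProduct_mul_self_le {L : ℕ} (v g : Fin L → ℝ) :
    (v ⬝ᵥ g) * (v ⬝ᵥ g) ≤ (v ⬝ᵥ v) * (g ⬝ᵥ g) := by
  have h := Finset.sum_mul_sq_le_sq_mul_sq Finset.univ v g
  simp only [dotProduct]
  simpa only [sq] using h

theorem dotProduct_self_le_channelMatrix {L : ℕ} {s : ℝ} (hs : 0 ≤ s) (g v : Fin L → ℝ) :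
    v ⬝ᵥ v ≤ v ⬝ᵥ channelMatrix s g *ᵥ v := by
  rw [dotProduct_channelMatrix_mulVec, dotProduct_comm g v]
  nlinarith [mul_le_mul_of_nonneg_left (dotProduct_mul_self_le v g) hs]

theorem isSymm_channelMatrix {L : ℕ} (s : ℝ) (g : Fin L → ℝ) : (channelMatrix s g).IsSymm := by
  simp [channelMatrix, Matrix.IsSymm, transpose_sub, transpose_smul, transpose_vecMulVec]

theorem posDef_channelMatrix {L : ℕ} {s : ℝ} (hs : 0 ≤ s) (g : Fin L → ℝ) :
    (channelMatrix s g).PosDef := by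
  apply PosDef.of_dotProduct_mulVec_pos
  · rw [Matrix.IsHermitian, conjTranspose_eq_transpose_of_trivial]
    exact isSymm_channelMatrix s g
  · intro x hx
    rw [star_trivial]
    refine lt_of_lt_of_le ?_ (dotProduct_self_le_channelMatrix hs g x)
    simpa using dotProduct_star_self_pos_iff.mpr hx

theorem posDef_mul_mul_transpose {k L : ℕ} {M : Matrix (Fin L) (Fin L) ℝ} (hM : M.PosDef)
    {X : Matrix (Fin k) (Fin L) ℝ} (hX : LinearIndependent ℝ X.row) : (X * M * Xᵀ).PosDef := by
  have := hM.mul_mul_conjTranspose_same (vecMul_injective_iff.mpr hX)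
  rwa [conjTranspose_eq_transpose_of_trivial] at this

/-- Fischer's inequality: adjoining one row multiplies the Gram determinant by at most the squared
length of that row. -/
theorem det_append_row_le {k L : ℕ} {M : Matrix (Fin L) (Fin L) ℝ} (hM : M.PosDef)
    {X : Matrix (Fin k) (Fin L) ℝ} (hX : LinearIndependent ℝ X.row) (v : Fin L → ℝ) :
    (of (Fin.append X ![v]) * M * (of (Fin.append X ![v]))ᵀ).det ≤
      (X * M * Xᵀ).det * (v ⬝ᵥ M *ᵥ v) := by
  have hpos := posDef_mul_mul_transpose hM hX
  have : Invertible (X * M * Xᵀ) := hpos.isUnit.invertible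
  set V : Matrix (Fin 1) (Fin L) ℝ := of ![v] with hV
  have hMt : Mᵀ = M := by
    have := hM.isHermitian
    rwa [Matrix.IsHermitian, conjTranspose_eq_transpose_of_trivial] at this
  have hsub : (of (Fin.append X ![v]) * M * (of (Fin.append X ![v]))ᵀ).submatrix
      finSumFinEquiv finSumFinEquiv =
      fromBlocks (X * M * Xᵀ) (X * M * Vᵀ) (V * M * Xᵀ) (V * M * Vᵀ) := by
    have hl : ∀ i, Fin.append X ![v] (Fin.castAdd 1 i) = X i := fun i => Fin.append_left _ _ i
    have hr : ∀ i, Fin.append X ![v] (Fin.natAdd k i) = V i := fun i => Fin.append_right _ _ i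
    ext (i | i) (j | j) <;>
      simp only [submatrix_apply, mul_apply, transpose_apply, of_apply, fromBlocks_apply₁₁,
        fromBlocks_apply₁₂, fromBlocks_apply₂₁, fromBlocks_apply₂₂, finSumFinEquiv_apply_left,
        finSumFinEquiv_apply_right, hl, hr]
  rw [← det_submatrix_equiv_self finSumFinEquiv, hsub, det_fromBlocks₁₁, det_fin_one]
  refine mul_le_mul_of_nonneg_left ?_ hpos.det_pos.le
  have h1 : (V * M * Vᵀ) 0 0 = v ⬝ᵥ M *ᵥ v := by
    rw [Matrix.mul_assoc, mul_apply]
    simp only [dotProduct, mulVec, mul_apply, hV, transpose_apply, of_apply, cons_val_zero]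
  have h2 : 0 ≤ (V * M * Xᵀ * ⅟(X * M * Xᵀ) * (X * M * Vᵀ)) 0 0 := by
    have hps := hpos.inv.posSemidef.conjTranspose_mul_mul_same (X * M * Vᵀ)
    rw [conjTranspose_eq_transpose_of_trivial, transpose_mul, transpose_mul, transpose_transpose,
      hMt, ← Matrix.mul_assoc V] at hps
    rw [invOf_eq_nonsing_inv]
    exact hps.diag_nonneg
  rw [Matrix.sub_apply, h1]
  linarith

theorem exists_eq_mul_of_row_mem_span {k L : ℕ} {X Y : Matrix (Fin k) (Fin L) ℝ}
    (h : ∀ i, Y i ∈ Submodule.span ℝ (Set.range X.row)) :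
    ∃ P : Matrix (Fin k) (Fin k) ℝ, Y = P * X := by
  have h' : ∀ i, ∃ c : Fin k → ℝ, ∑ j, c j • X j = Y i := fun i =>
    (Submodule.mem_span_range_iff_exists_fun ℝ).mp (h i)
  choose P hP using h'
  refine ⟨of P, ?_⟩
  ext i l
  rw [← hP i, mul_apply]
  simp

/-- Gram determinants of two bases of the same space with respect to two forms are proportional. -/
theorem det_gram_mul_mul_transpose {k L : ℕ} (P : Matrix (Fin k) (Fin k) ℝ)
    (X : Matrix (Fin k) (Fin L) ℝ) (M : Matrix (Fin L) (Fin L) ℝ) :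
    (P * X * M * (P * X)ᵀ).det = P.det ^ 2 * (X * M * Xᵀ).det := by
  have : P * X * M * (P * X)ᵀ = P * (X * M * Xᵀ) * Pᵀ := by
    rw [transpose_mul]; simp only [Matrix.mul_assoc]
  rw [this, det_mul, det_mul, det_transpose]
  ring

theorem le_det_gram_channelMatrix {k L : ℕ} {s : ℝ} (hs : 0 ≤ s) (g n : Fin L → ℝ)
    (hn : n ⬝ᵥ n ≤ 1) {X : Matrix (Fin k) (Fin L) ℝ}
    (hXn : X *ᵥ n = 0) (hdet : 1 ≤ (X * Xᵀ).det) :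
    (1 + s * (g ⬝ᵥ g)) ^ k * (1 + s * (n ⬝ᵥ g) ^ 2) ≤
      (1 + s * (g ⬝ᵥ g)) * (X * channelMatrix s g * Xᵀ).det := by
  set c := 1 + s * (g ⬝ᵥ g) with hc
  have hgg : 0 ≤ g ⬝ᵥ g := by simpa using dotProduct_star_self_nonneg g
  have hc0 : 0 < c := by positivity
  set w := X *ᵥ g with hw
  have hunit : IsUnit (X * Xᵀ).det := (by linarith : (X * Xᵀ).det ≠ 0).isUnit
  set u := (X * Xᵀ)⁻¹ *ᵥ w with hu
  have hHu : (X * Xᵀ) *ᵥ u = w := by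
    rw [hu, mulVec_mulVec, mul_nonsing_inv _ hunit, one_mulVec]
  set p := u ᵥ* X with hp
  have hpg : p ⬝ᵥ g = u ⬝ᵥ w := by rw [hp, hw, dotProduct_mulVec]
  have hpn : p ⬝ᵥ n = 0 := by rw [hp, ← dotProduct_mulVec, hXn, dotProduct_zero]
  have hpp : p ⬝ᵥ p = u ⬝ᵥ w := by
    rw [← hHu, ← mulVec_mulVec, mulVec_transpose, dotProduct_mulVec]
  have hkey : u ⬝ᵥ w ≤ g ⬝ᵥ g - (n ⬝ᵥ g) ^ 2 := by
    have h0 : 0 ≤ (g - p - (n ⬝ᵥ g) • n) ⬝ᵥ (g - p - (n ⬝ᵥ g) • n) := by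
      simpa using dotProduct_star_self_nonneg (g - p - (n ⬝ᵥ g) • n)
    simp only [sub_dotProduct, dotProduct_sub, smul_dotProduct, dotProduct_smul, smul_eq_mul,
      dotProduct_comm g p, dotProduct_comm g n, dotProduct_comm n p, hpg, hpn, hpp] at h0
    nlinarith [sq_nonneg (n ⬝ᵥ g)]
  have hfac : X * channelMatrix s g * Xᵀ = (c • (X * Xᵀ)) *
      (1 + replicateCol Unit (c⁻¹ • u) * replicateRow Unit (-s • w)) := by
    have h1 : (X * Xᵀ) * replicateCol Unit u = replicateCol Unit w := by
      rw [← replicateCol_mulVec, hHu]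
    have h2 : replicateCol Unit w * replicateRow Unit w = X * vecMulVec g g * Xᵀ := by
      rw [← vecMulVec_eq, hw, mul_vecMulVec, vecMulVec_mul, vecMul_transpose]
    have h3 : (X * Xᵀ) * (replicateCol Unit (c⁻¹ • u) * replicateRow Unit (-s • w)) =
        (-s * c⁻¹) • (X * vecMulVec g g * Xᵀ) := by
      rw [← Matrix.mul_assoc, replicateCol_smul, replicateRow_smul, Matrix.mul_smul,
        Matrix.mul_smul, h1, Matrix.smul_mul, h2, smul_smul]
    rw [Matrix.mul_add, Matrix.mul_one, Matrix.smul_mul, h3, smul_smul,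
      show c * (-s * c⁻¹) = -s by field_simp, channelMatrix, ← hc]
    simp only [Matrix.mul_sub, Matrix.sub_mul, Matrix.mul_smul, Matrix.smul_mul, Matrix.mul_one]
    rw [neg_smul, sub_eq_add_neg]
  rw [hfac, det_mul, det_smul, Fintype.card_fin, det_one_add_replicateCol_mul_replicateRow]
  simp only [smul_dotProduct, dotProduct_smul, smul_eq_mul]
  rw [dotProduct_comm w u]
  have h3 : c * (c ^ k * (X * Xᵀ).det * (1 + -s * (c⁻¹ * (u ⬝ᵥ w)))) =
      c ^ k * ((X * Xᵀ).det * (c - s * (u ⬝ᵥ w))) := by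
    field_simp
    ring
  have h4 : c ^ k * (1 + s * (n ⬝ᵥ g) ^ 2) ≤ c ^ k * ((X * Xᵀ).det * (c - s * (u ⬝ᵥ w))) := by
    refine mul_le_mul_of_nonneg_left ?_ (by positivity)
    have h5 : 1 + s * (n ⬝ᵥ g) ^ 2 ≤ c - s * (u ⬝ᵥ w) := by
      rw [hc]; nlinarith
    have h6 : 0 ≤ s * (n ⬝ᵥ g) ^ 2 := by positivity
    nlinarith
  linarith [h3, h4]

end GramDeterminants

section IntegerBases

open Matrix

/-- The real matrix whose rows are the given integer vectors. -/
def intRows {k L : ℕ} (A : Fin k → Fin L → ℤ) : Matrix (Fin k) (Fin L) ℝ :=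
  of fun i j => (A i j : ℝ)

/-- A tuple of integer vectors that is a real basis of `W`. -/
def IsIntBasis {L : ℕ} (W : Submodule ℝ (Fin L → ℝ)) (p : Σ k, Fin k → Fin L → ℤ) : Prop :=
  LinearIndependent ℝ (intRows p.2).row ∧ Submodule.span ℝ (Set.range (intRows p.2).row) = W

theorem IsIntBasis.fst_eq {L : ℕ} {W : Submodule ℝ (Fin L → ℝ)} {p : Σ k, Fin k → Fin L → ℤ}
    (hp : IsIntBasis W p) : p.1 = Module.finrank ℝ W := by
  rw [← hp.2, finrank_span_eq_card hp.1, Fintype.card_fin]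

theorem det_intRows_mul_transpose {k L : ℕ} (A : Fin k → Fin L → ℤ) :
    (intRows A * (intRows A)ᵀ).det = ((of A * (of A)ᵀ).det : ℤ) := by
  have h : intRows A * (intRows A)ᵀ = (of A * (of A)ᵀ).map (Int.castRingHom ℝ) := by
    ext i j
    simp [mul_apply, intRows]
  rw [h, ← RingHom.mapMatrix_apply, ← RingHom.map_det]
  rfl

theorem one_le_det_intRows {k L : ℕ} {A : Fin k → Fin L → ℤ}
    (hA : LinearIndependent ℝ (intRows A).row) : 1 ≤ (intRows A * (intRows A)ᵀ).det := by
  have h : 0 < (intRows A * (intRows A)ᵀ).det := by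
    have := (posDef_mul_mul_transpose (Matrix.PosDef.one (n := Fin L) (R := ℝ)) hA).det_pos
    rwa [Matrix.mul_one] at this
  rw [det_intRows_mul_transpose] at h ⊢
  exact_mod_cast h

theorem exists_minimal_intBasis {L : ℕ} {W : Submodule ℝ (Fin L → ℝ)}
    (h : ∃ p, IsIntBasis W p) :
    ∃ p, IsIntBasis W p ∧ ∀ q, IsIntBasis W q →
      (intRows p.2 * (intRows p.2)ᵀ).det ≤ (intRows q.2 * (intRows q.2)ᵀ).det := by
  obtain ⟨p, hp, hmin⟩ := (measure fun p : Σ k, Fin k → Fin L → ℤ =>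
    ((of p.2 * (of p.2)ᵀ).det).toNat).wf.has_min {p | IsIntBasis W p} h
  refine ⟨p, hp, fun q hq => ?_⟩
  have h1 : ((of p.2 * (of p.2)ᵀ).det).toNat ≤ ((of q.2 * (of q.2)ᵀ).det).toNat :=
    not_lt.mp (hmin q hq)
  have h2 := one_le_det_intRows hp.1
  have h3 := one_le_det_intRows hq.1
  rw [det_intRows_mul_transpose] at h2 h3 ⊢
  rw [det_intRows_mul_transpose]
  norm_cast at h2 h3 ⊢
  omega

theorem det_gram_le_of_minimal {L : ℕ} {W : Submodule ℝ (Fin L → ℝ)}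
    {p q : Σ k, Fin k → Fin L → ℤ} (hp : IsIntBasis W p) (hq : IsIntBasis W q)
    (hpq : (intRows p.2 * (intRows p.2)ᵀ).det ≤ (intRows q.2 * (intRows q.2)ᵀ).det)
    {M : Matrix (Fin L) (Fin L) ℝ} (hM : M.PosDef) :
    (intRows p.2 * M * (intRows p.2)ᵀ).det ≤ (intRows q.2 * M * (intRows q.2)ᵀ).det := by
  obtain ⟨k, A⟩ := p
  obtain ⟨k', A'⟩ := q
  obtain rfl : k = k' := hp.fst_eq.trans hq.fst_eq.symm
  obtain ⟨P, hP⟩ := exists_eq_mul_of_row_mem_span (X := intRows A) (Y := intRows A') (by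
    intro i
    have h := hp.2
    simp only at h
    rw [h, ← hq.2]
    exact Submodule.subset_span ⟨i, rfl⟩)
  have h1 := det_gram_mul_mul_transpose P (intRows A) 1
  have h2 := det_gram_mul_mul_transpose P (intRows A) M
  rw [← hP] at h1 h2
  rw [Matrix.mul_one, Matrix.mul_one] at h1
  simp only at hpq ⊢
  rw [h1] at hpq
  rw [h2]
  have h3 : 1 ≤ P.det ^ 2 := by
    have := one_le_det_intRows hp.1
    simp only at this
    by_contra! h
    nlinarith
  have h4 := (posDef_mul_mul_transpose hM hp.1).det_pos
  simp only at h4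
  nlinarith

theorem IsIntBasis.append {L : ℕ} {W : Submodule ℝ (Fin L → ℝ)} {p : Σ k, Fin k → Fin L → ℤ}
    (hp : IsIntBasis W p) {v : Fin L → ℤ} (hv : (fun j => (v j : ℝ)) ∉ W) :
    IsIntBasis (W ⊔ Submodule.span ℝ {fun j => (v j : ℝ)}) ⟨p.1 + 1, Fin.append p.2 ![v]⟩ ∧
      intRows (Fin.append p.2 ![v]) = of (Fin.append (intRows p.2) ![fun j => (v j : ℝ)]) := by
  have heq : intRows (Fin.append p.2 ![v]) =
      of (Fin.append (intRows p.2) ![fun j => (v j : ℝ)]) := by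
    ext i j
    refine Fin.addCases (fun i => ?_) (fun i => ?_) i
    · exact (congrArg (fun w : Fin L → ℤ => (w j : ℝ)) (Fin.append_left p.2 ![v] i)).trans
        (congrFun (Fin.append_left (intRows p.2).row ![fun j => (v j : ℝ)] i) j).symm
    · refine (congrArg (fun w : Fin L → ℤ => (w j : ℝ)) (Fin.append_right p.2 ![v] i)).trans
        (Eq.trans ?_ (congrFun (Fin.append_right (intRows p.2).row ![fun j => (v j : ℝ)] i) j).symm)
      fin_cases i
      rfl
  have hrow : (intRows (Fin.append p.2 ![v])).row =
      Fin.snoc (intRows p.2).row (fun j => (v j : ℝ)) := by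
    rw [heq]
    exact Fin.append_right_eq_snoc _ _
  refine ⟨⟨?_, ?_⟩, heq⟩
  · simp only [hrow]
    rw [linearIndependent_finSnoc]
    exact ⟨hp.1, by rwa [hp.2]⟩
  · simp only [hrow]
    rw [Fin.range_snoc, Set.insert_eq, Set.union_comm, Submodule.span_union, hp.2]

end IntegerBases

section Nondivergence

open Matrix

theorem det_mem_pow {k : ℕ} {P : Submodule ℝ (ℝ → ℝ)} (hP : 1 ≤ P)
    {E : ℝ → Matrix (Fin k) (Fin k) ℝ} (hE : ∀ i j, (fun x => E x i j) ∈ P) {n : ℕ} (hk : k ≤ n) :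
    (fun x => (E x).det) ∈ P ^ n := by
  have hprod : ∀ (σ : Equiv.Perm (Fin k)) (T : Finset (Fin k)),
      (∏ i ∈ T, fun x => E x (σ i) i) ∈ P ^ T.card := by
    intro σ T
    induction T using Finset.induction_on with
    | empty => simp
    | insert a T ha ih =>
      rw [Finset.prod_insert ha, Finset.card_insert_of_notMem ha, pow_succ']
      exact Submodule.mul_mem_mul (hE _ _) ih
  have hdet : (fun x => (E x).det) =
      ∑ σ : Equiv.Perm (Fin k), (Equiv.Perm.sign σ : ℤ) • ∏ i, fun x => E x (σ i) i := by
    ext x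
    rw [det_apply, Finset.sum_apply]
    refine Finset.sum_congr rfl fun σ _ => ?_
    rw [Pi.smul_apply, Finset.prod_apply]
    rfl
  rw [hdet]
  refine Submodule.sum_mem _ fun σ _ => ?_
  have h1 := hprod σ Finset.univ
  rw [Finset.card_univ, Fintype.card_fin] at h1
  have h2 : P ^ k ≤ P ^ n := pow_le_pow_right' hP hk
  exact zsmul_mem (h2 h1) _

/-- Gram determinants along an analytic curve lie in a fixed finite-dimensional space of analytic
functions, hence are uniformly good. -/
theorem exists_good_det {L : ℕ} (g : Fin L → ℝ → ℝ) (hg : ∀ i, AnalyticOnNhd ℝ (g i) Set.univ)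
    (x₀ : ℝ) :
    ∃ δ > 0, ∃ C > (0 : ℝ), ∃ α > (0 : ℝ), ∀ (κ s : ℝ) (k : ℕ) (X : Matrix (Fin k) (Fin L) ℝ),
      k ≤ L → ∀ a b : ℝ, a ≤ b → x₀ - δ ≤ a → b ≤ x₀ + δ → ∀ M e : ℝ, 0 < M → 0 < e →
      (∃ y ∈ Set.Icc a b, M ≤ |κ * (X * channelMatrix s (fun i => g i y) * Xᵀ).det|) →
      volume {y ∈ Set.Icc a b | |κ * (X * channelMatrix s (fun i => g i y) * Xᵀ).det| < e * M} ≤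
        ENNReal.ofReal (C * e ^ α * (b - a)) := by
  set S : Set (ℝ → ℝ) := insert 1 (Set.range fun p : Fin L × Fin L => g p.1 * g p.2) with hS
  set P := Submodule.span ℝ S with hPdef
  have hP1 : (1 : ℝ → ℝ) ∈ P := Submodule.subset_span (Set.mem_insert _ _)
  have hPg : ∀ i j, g i * g j ∈ P := fun i j =>
    Submodule.subset_span (Set.mem_insert_of_mem _ ⟨(i, j), rfl⟩)
  have hPan : ∀ h ∈ P, AnalyticOnNhd ℝ h Set.univ := by
    intro h hh
    induction hh using Submodule.span_induction with
    | mem x hx =>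
      rcases hx with rfl | ⟨p, rfl⟩
      · exact analyticOnNhd_const
      · exact (hg _).mul (hg _)
    | zero => exact analyticOnNhd_const
    | add f g _ _ hf hg => exact hf.add hg
    | smul c f _ hf => exact (analyticOnNhd_const (v := c)).smul hf
  have hPow : ∀ h ∈ P ^ L, AnalyticOnNhd ℝ h Set.univ := by
    intro h hh
    refine Submodule.pow_induction_on_left P (C := fun h => AnalyticOnNhd ℝ h Set.univ)
      (fun r => analyticOnNhd_const) (fun x y hx hy => hx.add hy)
      (fun m hm x hx => (hPan m hm).mul hx) hh
  have hfg : (P ^ L).FG := Submodule.FG.pow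
    (Submodule.fg_span ((Set.finite_range _).insert _)) L
  obtain ⟨T, hT⟩ := hfg
  obtain ⟨δ, hδ, C, hC, α, hα, h⟩ := exists_good_of_analytic (fun t : T => (t : ℝ → ℝ))
    (fun t => hPow _ (hT ▸ Submodule.subset_span t.2)) x₀
  refine ⟨δ, hδ, C, hC, α, hα, fun κ s k X hk => ?_⟩
  refine h (fun y => κ * (X * channelMatrix s (fun i => g i y) * Xᵀ).det) ?_
  rw [Subtype.range_coe_subtype, Finset.setOfPred_mem, hT]
  refine (P ^ L).smul_mem κ (det_mem_pow (Submodule.one_le.mpr hP1) (fun i j => ?_) hk)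
  have hent : (fun x => (X * channelMatrix s (fun i => g i x) * Xᵀ) i j) =
      ∑ l, ∑ l', (X i l' * X j l) • ((if l' = l then (1 : ℝ) else 0) •
        ((1 : ℝ → ℝ) + s • ∑ r, g r * g r) - s • (g l' * g l)) := by
    ext x
    simp only [mul_apply, Finset.sum_apply, Finset.sum_mul, transpose_apply, Pi.smul_apply,
      Pi.sub_apply, Pi.add_apply, Pi.mul_apply, channelMatrix, Matrix.sub_apply, Matrix.smul_apply,
      Matrix.one_apply, vecMulVec_apply, smul_eq_mul, dotProduct, Pi.one_apply]
    refine Finset.sum_congr rfl fun l _ => Finset.sum_congr rfl fun l' _ => ?_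
    split_ifs <;> ring
  rw [hent]
  refine Submodule.sum_mem _ fun l _ => Submodule.sum_mem _ fun l' _ => P.smul_mem _ ?_
  exact P.sub_mem (P.smul_mem _ (P.add_mem hP1 (P.smul_mem _
    (Submodule.sum_mem _ fun r _ => hPg r r)))) (P.smul_mem _ (hPg _ _))

theorem exists_le_sq_dotProduct {L : ℕ} (g : Fin L → ℝ → ℝ)
    (hg : ∀ i, AnalyticOnNhd ℝ (g i) Set.univ) (hli : LinearIndependent ℝ g) {a b : ℝ}
    (hab : a < b) :
    ∃ c > 0, ∀ n : Fin L → ℝ, n ⬝ᵥ n = 1 → ∃ y ∈ Set.Icc a b, c ≤ (n ⬝ᵥ fun i => g i y) ^ 2 := by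
  have hcomp : IsCompact {n : Fin L → ℝ | n ⬝ᵥ n = 1} := by
    refine Metric.isCompact_of_isClosed_isBounded ?_ ?_
    · exact isClosed_eq (by fun_prop) continuous_const
    · refine (Metric.isBounded_closedBall (x := (0 : Fin L → ℝ)) (r := 1)).subset ?_
      intro n hn
      rw [mem_closedBall_zero_iff, pi_norm_le_iff_of_nonneg zero_le_one]
      intro i
      have h1 : n i * n i ≤ 1 := by
        rw [← (show n ⬝ᵥ n = 1 from hn)]
        exact Finset.single_le_sum (f := fun i => n i * n i)
          (fun i _ => mul_self_nonneg _) (Finset.mem_univ i)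
      rw [Real.norm_eq_abs, ← sq_le_one_iff_abs_le_one]
      nlinarith
  suffices h : ∃ c > 0, ∀ n ∈ {n : Fin L → ℝ | n ⬝ᵥ n = 1},
      ∃ y ∈ Set.Icc a b, c ≤ (n ⬝ᵥ fun i => g i y) ^ 2 from h
  refine IsCompact.induction_on hcomp (p := fun s => ∃ c > 0, ∀ n ∈ s,
      ∃ y ∈ Set.Icc a b, c ≤ (n ⬝ᵥ fun i => g i y) ^ 2) ?_ ?_ ?_ ?_
  · exact ⟨1, one_pos, by simp⟩
  · rintro s t hst ⟨c, hc, h⟩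
    exact ⟨c, hc, fun n hn => h n (hst hn)⟩
  · rintro s t ⟨c, hc, h⟩ ⟨c', hc', h'⟩
    refine ⟨min c c', lt_min hc hc', ?_⟩
    rintro n (hn | hn)
    · obtain ⟨y, hy, hy'⟩ := h n hn
      exact ⟨y, hy, (min_le_left _ _).trans hy'⟩
    · obtain ⟨y, hy, hy'⟩ := h' n hn
      exact ⟨y, hy, (min_le_right _ _).trans hy'⟩
  · intro n hn
    obtain ⟨y, hy, hny⟩ : ∃ y ∈ Set.Icc a b, (n ⬝ᵥ fun i => g i y) ≠ 0 := by
      by_contra! hzero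
      have han : AnalyticOnNhd ℝ (∑ i, n i • g i) Set.univ := by
        apply Finset.analyticOnNhd_sum
        intro i _
        exact (analyticOnNhd_const (v := n i)).smul (hg i)
      have hev : (∑ i, n i • g i) =ᶠ[nhds ((a + b) / 2)] 0 := by
        filter_upwards [Icc_mem_nhds (show a < (a + b) / 2 by linarith)
          (show (a + b) / 2 < b by linarith)] with y hy
        rw [Finset.sum_apply]
        exact hzero y hy
      have hz := han.eqOn_zero_of_preconnected_of_eventuallyEq_zero isPreconnected_univ
        (Set.mem_univ _) hev
      have hz' : ∑ i, n i • g i = 0 := funext fun x => hz (Set.mem_univ x)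
      have hn0 : n = 0 := funext fun i => (Fintype.linearIndependent_iff.mp hli) n hz' i
      rw [hn0] at hn
      simp at hn
    have hpos : 0 < (n ⬝ᵥ fun i => g i y) ^ 2 := by positivity
    have hcont : Continuous fun n : Fin L → ℝ => (n ⬝ᵥ fun i => g i y) ^ 2 := by fun_prop
    have hev := hcont.continuousAt.eventually_const_lt (half_lt_self hpos)
    exact ⟨_, mem_nhdsWithin_of_mem_nhds hev, _, half_pos hpos, fun n' hn' =>
      ⟨y, hy, le_of_lt hn'⟩⟩

theorem exists_unit_mulVec_eq_zero {k L : ℕ} (hk : k < L) (X : Matrix (Fin k) (Fin L) ℝ) :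
    ∃ n : Fin L → ℝ, n ⬝ᵥ n = 1 ∧ X *ᵥ n = 0 := by
  have hker : LinearMap.ker X.mulVecLin ≠ ⊥ := by
    apply LinearMap.ker_ne_bot_of_finrank_lt
    simpa using hk
  obtain ⟨n, hn, hn0⟩ := (Submodule.ne_bot_iff _).mp hker
  have hpos : 0 < n ⬝ᵥ n := by simpa using dotProduct_star_self_pos_iff.mpr hn0
  refine ⟨(Real.sqrt (n ⬝ᵥ n))⁻¹ • n, ?_, ?_⟩
  · rw [smul_dotProduct, dotProduct_smul, smul_eq_mul, smul_eq_mul, ← mul_assoc, ← mul_inv,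
      Real.mul_self_sqrt hpos.le, inv_mul_cancel₀ hpos.ne']
  · rw [mulVec_smul]
    rw [LinearMap.mem_ker, mulVecLin_apply] at hn
    rw [hn, smul_zero]

/-- Lower bound for normalized Gram determinants in terms of a normal direction. -/
theorem le_scaled_det_gram {k L : ℕ} (hkL : k + 1 ≤ L) {τ c₀ t : ℝ} (hτ : 1 ≤ τ) (hc₀ : 0 < c₀)
    (hc₀' : c₀ ≤ 1) (ht0 : 0 ≤ t) (ht1 : k + 1 = L → t ≤ 1) {g n : Fin L → ℝ}
    (hg : c₀ ≤ g ⬝ᵥ g) (hn : n ⬝ᵥ n ≤ 1) (ht : k + 1 < L → t ≤ (n ⬝ᵥ g) ^ 2)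
    {X : Matrix (Fin (k + 1)) (Fin L) ℝ} (hXn : X *ᵥ n = 0) (hdet : 1 ≤ (X * Xᵀ).det) :
    c₀ ^ L * t ≤ (τ ^ (L - 1))⁻¹ ^ (k + 1) * (X * channelMatrix (τ ^ L) g * Xᵀ).det := by
  have hτ0 : 0 < τ := by linarith
  set κ := (τ ^ (L - 1))⁻¹ with hκ
  set s := τ ^ L with hs
  have hs0 : 0 < s := by positivity
  have hκ0 : 0 < κ := by positivity
  have hκs : κ * s = τ := by
    rw [hκ, hs, show τ ^ L = τ ^ (L - 1) * τ by rw [← pow_succ]; congr 1; omega]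
    field_simp
  set D := (X * channelMatrix s g * Xᵀ).det with hD
  set c := 1 + s * (g ⬝ᵥ g) with hc
  have hc1 : 0 < c := by have : 0 ≤ s * (g ⬝ᵥ g) := mul_nonneg hs0.le (hc₀.le.trans hg); linarith
  have h1 := le_det_gram_channelMatrix hs0.le g n hn hXn hdet
  rw [← hc, pow_succ', mul_assoc] at h1
  have h2 : c ^ k * (1 + s * (n ⬝ᵥ g) ^ 2) ≤ D := le_of_mul_le_mul_left h1 hc1
  have h3 : τ * c₀ ≤ κ * c := by
    have : κ * c = κ + τ * (g ⬝ᵥ g) := by rw [hc, ← hκs]; ring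
    rw [this]
    nlinarith
  have h4 : t ≤ τ ^ k * (κ * (1 + s * (n ⬝ᵥ g) ^ 2)) := by
    rcases hkL.lt_or_eq with hlt | heq
    · have h5 : 1 ≤ τ ^ k := one_le_pow₀ hτ
      have h6 : t ≤ κ * (1 + s * (n ⬝ᵥ g) ^ 2) := by
        have : κ * (1 + s * (n ⬝ᵥ g) ^ 2) = κ + τ * (n ⬝ᵥ g) ^ 2 := by rw [← hκs]; ring
        rw [this]
        nlinarith [ht hlt, sq_nonneg (n ⬝ᵥ g)]
      nlinarith
    · have h5 : τ ^ k * κ = 1 := by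
        rw [hκ, show L - 1 = k by omega]
        exact mul_inv_cancel₀ (by positivity)
      rw [← mul_assoc, h5, one_mul]
      have := ht1 heq
      have : 0 ≤ s * (n ⬝ᵥ g) ^ 2 := by positivity
      linarith
  have h7 : (τ * c₀) ^ k ≤ (κ * c) ^ k := pow_le_pow_left₀ (by positivity) h3 k
  have h8 : c₀ ^ L ≤ c₀ ^ k := pow_le_pow_of_le_one hc₀.le hc₀' (by omega)
  have h9 : 0 ≤ κ * (1 + s * (n ⬝ᵥ g) ^ 2) := by positivity
  calc c₀ ^ L * t ≤ c₀ ^ k * (τ ^ k * (κ * (1 + s * (n ⬝ᵥ g) ^ 2))) := by gcongr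
    _ = (τ * c₀) ^ k * (κ * (1 + s * (n ⬝ᵥ g) ^ 2)) := by rw [mul_pow]; ring
    _ ≤ (κ * c) ^ k * (κ * (1 + s * (n ⬝ᵥ g) ^ 2)) := by gcongr
    _ = κ ^ (k + 1) * (c ^ k * (1 + s * (n ⬝ᵥ g) ^ 2)) := by rw [mul_pow]; ring
    _ ≤ κ ^ (k + 1) * D := by gcongr

end Nondivergence

section Nondivergence

open Matrix

instance {L : ℕ} : Nonempty (Σ k, Fin k → Fin L → ℤ) := ⟨⟨0, Fin.elim0⟩⟩

/-- Quantitative nondivergence: near a point where an analytic curve with linearly independent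
components does not vanish, the set of parameters whose quadratic form has a short integer vector
is small, uniformly in the scale. -/
theorem exists_volume_short_vector_le {L : ℕ} (g : Fin L → ℝ → ℝ)
    (hg : ∀ i, AnalyticOnNhd ℝ (g i) Set.univ) (hli : LinearIndependent ℝ g) (x₀ : ℝ)
    (hx₀ : (fun i => g i x₀) ≠ 0) :
    ∃ δ > 0, ∃ K > (0 : ℝ), ∃ α > (0 : ℝ), ∃ ρ > (0 : ℝ), ∀ τ ε : ℝ, 1 ≤ τ → 0 < ε → ε ≤ ρ →
      volume {x ∈ Set.Icc (x₀ - δ) (x₀ + δ) | ∃ v : Fin L → ℤ, v ≠ 0 ∧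
        (τ ^ (L - 1))⁻¹ * ((fun j => (v j : ℝ)) ⬝ᵥ
          channelMatrix (τ ^ L) (fun i => g i x) *ᵥ (fun j => (v j : ℝ))) < ε} ≤
        ENNReal.ofReal (K * ε ^ α) := by
  have hcontg : ∀ i, Continuous (g i) := fun i =>
    continuous_iff_continuousAt.mpr fun x => (hg i x (Set.mem_univ x)).continuousAt
  have hpos0 : 0 < (fun i => g i x₀) ⬝ᵥ fun i => g i x₀ := by
    simpa using dotProduct_star_self_pos_iff.mpr hx₀
  obtain ⟨δ₁, hδ₁, C, hC, α, hα, hgood⟩ := exists_good_det g hg x₀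
  have hcontgg : Continuous fun x => (fun i => g i x) ⬝ᵥ fun i => g i x :=
    Continuous.dotProduct (continuous_pi hcontg) (continuous_pi hcontg)
  obtain ⟨δ₂, hδ₂, hball⟩ := Metric.eventually_nhds_iff.mp
    (hcontgg.continuousAt.eventually_const_lt (half_lt_self hpos0))
  set δ := min δ₁ (δ₂ / 2) with hδdef
  have hδ : 0 < δ := lt_min hδ₁ (by positivity)
  set c₀ := min 1 (((fun i => g i x₀) ⬝ᵥ fun i => g i x₀) / 2) with hc₀def
  have hc₀ : 0 < c₀ := lt_min one_pos (by positivity)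
  have hc₀1 : c₀ ≤ 1 := min_le_left _ _
  have hgc : ∀ x ∈ Set.Icc (x₀ - δ) (x₀ + δ), c₀ ≤ (fun i => g i x) ⬝ᵥ fun i => g i x := by
    intro x hx
    refine (min_le_right _ _).trans (le_of_lt (hball ?_))
    rw [Real.dist_eq, abs_lt]
    have := min_le_right δ₁ (δ₂ / 2)
    constructor <;> linarith [hx.1, hx.2]
  obtain ⟨c, hc, hcn⟩ := exists_le_sq_dotProduct g hg hli
    (show x₀ - δ < x₀ + δ by linarith)
  obtain ⟨ρ, hρ0, hρc, hρC⟩ : ∃ ρ : ℝ, 0 < ρ ∧ ρ ≤ c₀ ^ L * min 1 c ∧ C * ρ ^ α < 1 / 5 := by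
    have htend : Filter.Tendsto (fun ρ : ℝ => C * ρ ^ α) (nhdsWithin 0 (Set.Ioi 0)) (nhds 0) := by
      have h1 : Filter.Tendsto (fun ρ : ℝ => C * ρ ^ α) (nhds 0) (nhds (C * 0 ^ α)) :=
        ((Real.continuousAt_rpow_const 0 α (Or.inr hα.le)).const_mul C)
      rw [Real.zero_rpow hα.ne', mul_zero] at h1
      exact h1.mono_left nhdsWithin_le_nhds
    have hev := htend.eventually_lt_const (show (0 : ℝ) < 1 / 5 by norm_num)
    have hmin : 0 < c₀ ^ L * min 1 c := by positivity
    obtain ⟨ρ, h1, h2, h3⟩ := (hev.and ((Ioo_mem_nhdsGT hmin))).exists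
    exact ⟨ρ, h2, h3.le, h1⟩
  refine ⟨δ, hδ, nondivConst (C / ρ ^ α) (Module.finrank ℝ (Fin L → ℝ) + 1) * (2 * δ) + 1,
    ?_, α, hα, ρ, hρ0, ?_⟩
  · have := nondivConst_nonneg (c := C / ρ ^ α) (by positivity)
      (Module.finrank ℝ (Fin L → ℝ) + 1)
    positivity
  intro τ ε hτ hε hερ
  have hτ0 : 0 < τ := by linarith
  set κ := (τ ^ (L - 1))⁻¹ with hκ
  have hκ0 : 0 < κ := by positivity
  have hs0 : 0 ≤ τ ^ L := by positivity
  choose! p hp hmin using fun (W : Submodule ℝ (Fin L → ℝ)) (hW : ∃ p, IsIntBasis W p) =>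
    exists_minimal_intBasis hW
  set M : ℝ → Matrix (Fin L) (Fin L) ℝ := fun x => channelMatrix (τ ^ L) (fun i => g i x) with hM
  have hMpos : ∀ x, (M x).PosDef := fun x => posDef_channelMatrix hs0 _
  set ψ : Submodule ℝ (Fin L → ℝ) → ℝ → ℝ := fun W x =>
    κ ^ (p W).1 * (intRows (p W).2 * M x * (intRows (p W).2)ᵀ).det with hψ
  set R : Set (Submodule ℝ (Fin L → ℝ)) := {W | ∃ p, IsIntBasis W p} with hR
  set Z : Set (Fin L → ℝ) := {w | ∃ v : Fin L → ℤ, v ≠ 0 ∧ w = fun j => (v j : ℝ)} with hZ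
  have hψpos : ∀ W ∈ R, ∀ x, 0 < ψ W x := fun W hW x =>
    mul_pos (by positivity) (posDef_mul_mul_transpose (hMpos x) (hp W hW).1).det_pos
  have hbot : ⊥ ∈ R := by
    refine ⟨⟨0, Fin.elim0⟩, linearIndependent_empty_type, ?_⟩
    rw [Set.range_eq_empty, Submodule.span_empty]
  have hrank : ∀ W ∈ R, (p W).1 ≤ L := by
    intro W hW
    rw [(hp W hW).fst_eq]
    simpa using Submodule.finrank_le W
  have hmain := nondivergence_flag R Z (fun w x => κ * (w ⬝ᵥ M x *ᵥ w)) ψ (x₀ - δ) (x₀ + δ) C α ρ ε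
    ?hZ hbot ?hR ?hψ0 ?hN ?hsub ?hcont hC.le ?hgood hρ0 hρC hε hερ
    (Module.finrank ℝ (Fin L → ℝ) + 1) ∅ (x₀ - δ) (x₀ + δ) le_rfl le_rfl (by simp) (by simp)
    (by simp) (by simp) (by simp) ?hsup
  case hZ =>
    rintro w ⟨v, hv, rfl⟩ h0
    apply hv
    ext j
    simpa using congrFun h0 j
  case hR =>
    rintro W hW w ⟨v, hv, rfl⟩
    by_cases hvW : (fun j => (v j : ℝ)) ∈ W
    · rwa [sup_eq_left.mpr ((Submodule.span_singleton_le_iff_mem _ _).mpr hvW)]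
    · exact ⟨_, ((hp W hW).append hvW).1⟩
  case hψ0 =>
    intro x
    have h := (hp ⊥ hbot).fst_eq
    rw [finrank_bot] at h
    have : IsEmpty (Fin (p ⊥).1) := by rw [h]; infer_instance
    simp only [hψ]
    rw [det_isEmpty, h, pow_zero, mul_one]
  case hN =>
    intro w _ x _
    have h := dotProduct_self_le_channelMatrix hs0 (fun i => g i x) w
    have h' : 0 ≤ w ⬝ᵥ w := by simpa using dotProduct_star_self_nonneg w
    exact mul_nonneg hκ0.le (h'.trans h)
  case hsub =>
    rintro W hW w ⟨v, hv, rfl⟩ hvW x _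
    obtain ⟨h1, h2⟩ := (hp W hW).append hvW
    have h3 := hmin _ ⟨_, h1⟩ _ h1
    have h4 := det_gram_le_of_minimal (hp _ ⟨_, h1⟩) h1 h3 (hMpos x)
    simp only at h4
    rw [h2] at h4
    have h5 := h4.trans (det_append_row_le (hMpos x) (hp W hW).1 (fun j => (v j : ℝ)))
    have h6 : (p (W ⊔ Submodule.span ℝ {fun j => (v j : ℝ)})).1 = (p W).1 + 1 :=
      (hp _ ⟨_, h1⟩).fst_eq.trans h1.fst_eq.symm
    have h7 : 0 ≤ κ ^ (p (W ⊔ Submodule.span ℝ {fun j => (v j : ℝ)})).1 := by positivity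
    refine (mul_le_mul_of_nonneg_left h5 h7).trans (le_of_eq ?_)
    rw [h6]
    simp only [hψ]
    ring
  case hcont =>
    intro W _
    have hMc : Continuous M := by
      refine continuous_matrix fun i j => ?_
      simp only [hM, channelMatrix, Matrix.sub_apply, Matrix.smul_apply, vecMulVec_apply,
        smul_eq_mul]
      exact ((continuous_const.add (continuous_const.mul hcontgg)).mul continuous_const).sub
        (continuous_const.mul ((hcontg i).mul (hcontg j)))
    exact continuous_const.mul (((continuous_const.matrix_mul hMc).matrix_mul
      continuous_const).matrix_det)
  case hgood =>
    intro W hW _ a b hab ha hb m e hm he hy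
    have hδ1 : δ ≤ δ₁ := min_le_left _ _
    have h := hgood (κ ^ (p W).1) (τ ^ L) (p W).1 (intRows (p W).2) (hrank W hW) a b hab
      (by linarith) (by linarith) m e hm he
    have habs : ∀ y, |κ ^ (p W).1 * (intRows (p W).2 * channelMatrix (τ ^ L) (fun i => g i y) *
        (intRows (p W).2)ᵀ).det| = ψ W y := fun y => abs_of_pos (hψpos W hW y)
    simp only [habs] at h
    exact h hy
  case hsup =>
    intro W hW hW0 _ _
    have hk0 : (p W).1 ≠ 0 := by
      rw [(hp W hW).fst_eq]
      exact fun h => hW0 (Submodule.finrank_eq_zero.mp h)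
    obtain ⟨k, hk⟩ := Nat.exists_eq_succ_of_ne_zero hk0
    have hkL := hrank W hW
    have hdet := one_le_det_intRows (hp W hW).1
    simp only [hψ]
    generalize p W = q at hk hkL hdet
    obtain ⟨k', A⟩ := q
    simp only at hk
    subst hk
    simp only at hkL hdet ⊢
    rcases hkL.lt_or_eq with hlt | heq
    · obtain ⟨n, hn, hXn⟩ := exists_unit_mulVec_eq_zero hlt (intRows A)
      obtain ⟨y, hy, hcy⟩ := hcn n hn
      exact ⟨y, hy, hρc.trans (le_scaled_det_gram hkL hτ hc₀ hc₀1 (by positivity)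
        (fun h => absurd h hlt.ne) (hgc y hy) hn.le (fun _ => (min_le_right _ _).trans hcy)
        hXn hdet)⟩
    · have hy : x₀ ∈ Set.Icc (x₀ - δ) (x₀ + δ) := ⟨by linarith, by linarith⟩
      exact ⟨x₀, hy, hρc.trans (le_scaled_det_gram (n := 0) hkL hτ hc₀ hc₀1 (by positivity)
        (fun _ => min_le_left _ _) (hgc _ hy) (by simp) (fun h => absurd heq h.ne)
        (by simp) hdet)⟩
  refine (measure_mono ?_).trans (hmain.trans (ENNReal.ofReal_le_ofReal ?_))
  · rintro x ⟨hx, v, hv, hlt⟩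
    exact ⟨hx, ⟨_, ⟨v, hv, rfl⟩, hlt⟩, by simp⟩
  · have : 0 < ε ^ α := Real.rpow_pos_of_pos hε α
    nlinarith

end Nondivergence

section AlmostEverywhere

open Matrix

/-- The quadratic forms of `channelMatrix` have no integer vectors that are much shorter than
what Minkowski's theorem predicts, along a geometric sequence of scales. -/
def HasNoShortVectors {L : ℕ} (g : Fin L → ℝ) : Prop :=
  g ≠ 0 ∧ ∀ j : ℕ, ∀ᶠ n : ℕ in Filter.atTop, ∀ v : Fin L → ℤ, v ≠ 0 →
    ((2 : ℝ) ^ (-(1 / ((j : ℝ) + 1)))) ^ n ≤ (((2 : ℝ) ^ n) ^ (L - 1))⁻¹ *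
      ((fun j => (v j : ℝ)) ⬝ᵥ channelMatrix (((2 : ℝ) ^ n) ^ L) g *ᵥ (fun j => (v j : ℝ)))

theorem measurableSet_hasNoShortVectors {L : ℕ} :
    MeasurableSet {g : Fin L → ℝ | HasNoShortVectors g} := by
  have h : {g : Fin L → ℝ | HasNoShortVectors g} = {0}ᶜ ∩ ⋂ j : ℕ, ⋃ N : ℕ, ⋂ n : {n : ℕ // N ≤ n},
      ⋂ v : {v : Fin L → ℤ // v ≠ 0}, {g | ((2 : ℝ) ^ (-(1 / ((j : ℝ) + 1)))) ^ n.1 ≤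
        (((2 : ℝ) ^ n.1) ^ (L - 1))⁻¹ * ((fun j => (v.1 j : ℝ)) ⬝ᵥ
          channelMatrix (((2 : ℝ) ^ n.1) ^ L) g *ᵥ (fun j => (v.1 j : ℝ)))} := by
    ext g
    simp [HasNoShortVectors, Filter.eventually_atTop]
  rw [h]
  refine (measurableSet_singleton _).compl.inter (MeasurableSet.iInter fun j =>
    MeasurableSet.iUnion fun N => MeasurableSet.iInter fun n => MeasurableSet.iInter fun v =>
      (isClosed_le continuous_const ?_).measurableSet)
  simp only [dotProduct_channelMatrix_mulVec]
  fun_prop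

theorem ae_ne_zero_of_linearIndependent {L : ℕ} (hL : 1 ≤ L) (g : Fin L → ℝ → ℝ)
    (hg : ∀ i, AnalyticOnNhd ℝ (g i) Set.univ) (hli : LinearIndependent ℝ g) :
    ∀ᵐ x : ℝ, (fun i => g i x) ≠ 0 := by
  let i₀ : Fin L := ⟨0, hL⟩
  have h : ∀ᵐ x : ℝ, g i₀ x ≠ 0 := by
    rcases (hg i₀).eqOn_zero_or_eventually_ne_zero_of_preconnected isPreconnected_univ with h0 | h0
    · exact absurd (funext fun x => h0 (Set.mem_univ x)) (hli.ne_zero i₀)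
    · have := ae_restrict_le_codiscreteWithin (μ := (volume : Measure ℝ)) MeasurableSet.univ h0
      rwa [Measure.restrict_univ] at this
  filter_upwards [h] with x hx h0
  exact hx (congrFun h0 i₀)

/-- Along an analytic curve with linearly independent components, almost every point has no short
integer vectors. -/
theorem ae_hasNoShortVectors_curve {L : ℕ} (hL : 1 ≤ L) (g : Fin L → ℝ → ℝ)
    (hg : ∀ i, AnalyticOnNhd ℝ (g i) Set.univ) (hli : LinearIndependent ℝ g) :
    ∀ᵐ x : ℝ, HasNoShortVectors fun i => g i x := by
  have hnull : volume {x : ℝ | (fun i => g i x) ≠ 0 ∧ ¬ HasNoShortVectors fun i => g i x} = 0 := by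
    refine measure_null_of_locally_null _ fun x₀ hx₀ => ?_
    obtain ⟨δ, hδ, K, hK, α, hα, ρ, hρ, h⟩ := exists_volume_short_vector_le g hg hli x₀ hx₀.1
    refine ⟨_, inter_mem_nhdsWithin _ (Icc_mem_nhds (show x₀ - δ < x₀ by linarith)
      (show x₀ < x₀ + δ by linarith)), ?_⟩
    have hae : ∀ j : ℕ, ∀ᵐ x : ℝ, x ∈ Set.Icc (x₀ - δ) (x₀ + δ) →
        ∀ᶠ n : ℕ in Filter.atTop, ∀ v : Fin L → ℤ, v ≠ 0 →
          ((2 : ℝ) ^ (-(1 / ((j : ℝ) + 1)))) ^ n ≤ (((2 : ℝ) ^ n) ^ (L - 1))⁻¹ *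
            ((fun j => (v j : ℝ)) ⬝ᵥ channelMatrix (((2 : ℝ) ^ n) ^ L) (fun i => g i x) *ᵥ
              (fun j => (v j : ℝ))) := by
      intro j
      set r : ℝ := (2 : ℝ) ^ (-(1 / ((j : ℝ) + 1))) with hr
      have hr0 : 0 < r := by positivity
      have hr1 : r < 1 := Real.rpow_lt_one_of_one_lt_of_neg one_lt_two
        (by rw [neg_lt_zero]; positivity)
      obtain ⟨N, hN⟩ := exists_pow_lt_of_lt_one hρ hr1
      have hbound : ∀ n, volume {x ∈ Set.Icc (x₀ - δ) (x₀ + δ) | ∃ v : Fin L → ℤ, v ≠ 0 ∧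
          (((2 : ℝ) ^ (n + N)) ^ (L - 1))⁻¹ * ((fun j => (v j : ℝ)) ⬝ᵥ
            channelMatrix (((2 : ℝ) ^ (n + N)) ^ L) (fun i => g i x) *ᵥ (fun j => (v j : ℝ))) <
              r ^ (n + N)} ≤ ENNReal.ofReal (K * (r ^ α) ^ (n + N)) := by
        intro n
        rw [Real.rpow_pow_comm hr0.le]
        exact h _ _ (one_le_pow₀ one_le_two) (by positivity)
          ((pow_le_pow_of_le_one hr0.le hr1.le (Nat.le_add_left N n)).trans hN.le)
      have hsum : Summable fun n => K * (r ^ α) ^ (n + N) :=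
        ((summable_nat_add_iff N).mpr (summable_geometric_of_lt_one (by positivity)
          (Real.rpow_lt_one hr0.le hr1 hα))).mul_left K
      have hfin := ((ENNReal.tsum_le_tsum hbound).trans_lt hsum.tsum_ofReal_lt_top).ne
      filter_upwards [ae_eventually_notMem hfin] with x hx hxI
      rw [← Filter.map_add_atTop_eq_nat N, Filter.eventually_map]
      filter_upwards [hx] with n hn v hv
      by_contra! hlt
      exact hn ⟨hxI, v, hv, hlt⟩
    rw [← ae_all_iff] at hae
    refine measure_mono_null ?_ (ae_iff.mp hae)
    rintro x ⟨⟨hx0, hx⟩, hxI⟩ hall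
    exact hx ⟨hx0, fun j => hall j hxI⟩
  filter_upwards [ae_ne_zero_of_linearIndependent hL g hg hli, measure_eq_zero_iff_ae_notMem.mp hnull]
    with x hx1 hx2
  by_contra h
  exact hx2 ⟨hx1, h⟩

end AlmostEverywhere

section CurveReduction

open Matrix

theorem exists_det_eval_ne_zero {X : Type*} {L : ℕ} {f : Fin L → X → ℝ}
    (hf : LinearIndependent ℝ f) : ∃ p : Fin L → X, (of fun i j => f i (p j)).det ≠ 0 := by
  set S : Set (Fin L → ℝ) := Set.range fun x i => f i x with hS
  have htop : Submodule.span ℝ S = ⊤ := by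
    by_contra hne
    obtain ⟨φ, hφ, hker⟩ := Submodule.exists_le_ker_of_lt_top _ (lt_top_iff_ne_top.mpr hne)
    apply hφ
    have hc : ∑ i, (φ fun j => if i = j then 1 else 0) • f i = 0 := by
      ext x
      have hx : φ (fun i => f i x) = 0 := hker (Submodule.subset_span ⟨x, rfl⟩)
      rw [LinearMap.pi_apply_eq_sum_univ] at hx
      rw [Finset.sum_apply, Pi.zero_apply]
      exact (Finset.sum_congr rfl fun i _ => mul_comm _ _).trans hx
    have hz := Fintype.linearIndependent_iff.mp hf _ hc
    ext i
    have h1 : (fun j => if i = j then (1 : ℝ) else 0) = Pi.single i 1 := by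
      ext j
      simp [Pi.single_apply, eq_comm]
    have h2 := hz i
    rw [h1] at h2
    simpa using h2
  obtain ⟨v, hv, -, hli⟩ := Submodule.exists_fun_fin_finrank_span_eq ℝ S
  have hrank : Module.finrank ℝ (Submodule.span ℝ S) = L := by
    rw [htop, finrank_top, Module.finrank_fin_fun]
  have hli' : LinearIndependent ℝ (v ∘ Fin.cast hrank.symm) :=
    hli.comp _ (Fin.cast_injective _)
  choose p hp using hv
  refine ⟨fun j => p (Fin.cast hrank.symm j), ?_⟩
  have hrow : LinearIndependent ℝ ((of fun i j => f i (p (Fin.cast hrank.symm j)))ᵀ).row := by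
    convert hli' using 1
    exact funext fun j => hp _
  rw [linearIndependent_rows_iff_isUnit, isUnit_iff_isUnit_det, det_transpose] at hrow
  exact hrow.ne_zero

theorem exists_polynomial_curve {m L : ℕ} (q : Fin L → Fin m → ℝ) :
    ∃ P : Fin m → Polynomial ℝ, (∀ k, (P k).eval 0 = 0) ∧
      ∀ (j : Fin L) (k : Fin m), (P k).eval ((j : ℝ) + 1) = q j k := by
  have hinj : Set.InjOn (fun i : Fin (L + 1) => (i : ℝ)) (Finset.univ : Finset (Fin (L + 1))) :=
    fun i _ j _ h => Fin.ext (Nat.cast_injective h)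
  have heval := fun (k : Fin m) (i : Fin (L + 1)) => Lagrange.eval_interpolate_at_node
    (Fin.cons 0 fun j => q j k : Fin (L + 1) → ℝ) hinj (Finset.mem_univ i)
  refine ⟨fun k => Lagrange.interpolate Finset.univ (fun i : Fin (L + 1) => (i : ℝ))
    (Fin.cons 0 fun j => q j k), fun k => ?_, fun j k => ?_⟩
  · simpa using heval k 0
  · simpa using heval k j.succ

/-- Almost every value of an analytic map with linearly independent components has no short integer
vectors. -/
theorem ae_hasNoShortVectors {m L : ℕ} (hL : 1 ≤ L) (f : Fin L → (Fin m → ℝ) → ℝ)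
    (hf : ∀ i, AnalyticOnNhd ℝ (f i) Set.univ) (hli : LinearIndependent ℝ f) :
    ∀ᵐ y : Fin m → ℝ, HasNoShortVectors fun i => f i y := by
  have hfc : ∀ i, Continuous (f i) := fun i =>
    continuous_iff_continuousAt.mpr fun x => (hf i x (Set.mem_univ x)).continuousAt
  obtain ⟨p, hp⟩ := exists_det_eval_ne_zero hli
  rw [ae_iff]
  refine measure_null_of_locally_null _ fun y₀ _ => ?_
  obtain ⟨P, hP0, hPq⟩ := exists_polynomial_curve fun j k => p j k - y₀ k
  set γ : ℝ → Fin m → ℝ := fun t k => (P k).eval t with hγ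
  have hγc : Continuous γ := continuous_pi fun k => (P k).continuous
  have hγ0 : γ 0 = 0 := funext hP0
  have hγan : AnalyticOnNhd ℝ γ Set.univ := by
    rw [analyticOnNhd_pi_iff]
    exact fun k => (AnalyticOnNhd.eval_polynomial (P k))
  have hdetc : Continuous fun y => (of fun i (j : Fin L) => f i (y + γ ((j : ℝ) + 1))).det := by
    refine Continuous.matrix_det (continuous_matrix fun i j => ?_)
    exact (hfc i).comp (continuous_id.add continuous_const)
  have hdet0 : (of fun i (j : Fin L) => f i (y₀ + γ ((j : ℝ) + 1))).det ≠ 0 := by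
    have : ∀ j : Fin L, y₀ + γ ((j : ℝ) + 1) = p j := by
      intro j
      ext k
      simp [hγ, hPq]
    simpa only [this] using hp
  obtain ⟨r, hr, hball⟩ := Metric.eventually_nhds_iff.mp (hdetc.continuousAt.eventually_ne hdet0)
  have hcurve : ∀ y ∈ Metric.ball y₀ r, ∀ᵐ t : ℝ, HasNoShortVectors fun i => f i (y + γ t) := by
    intro y hy
    refine ae_hasNoShortVectors_curve hL (fun i t => f i (y + γ t)) (fun i => ?_) ?_
    · exact (hf i).comp (analyticOnNhd_const.add hγan) (fun _ _ => Set.mem_univ _)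
    · rw [Fintype.linearIndependent_iff]
      intro c hc
      refine congrFun (eq_zero_of_vecMul_eq_zero (hball hy) (funext fun j => ?_))
      have := congrFun hc ((j : ℝ) + 1)
      simpa [vecMul, dotProduct] using this
  have hmeas : MeasurableSet {z : ℝ × (Fin m → ℝ) |
      z.2 ∈ Metric.ball y₀ r → HasNoShortVectors fun i => f i (z.2 + γ z.1)} := by
    have h1 : MeasurableSet {z : ℝ × (Fin m → ℝ) | z.2 ∈ Metric.ball y₀ r} :=
      measurable_snd measurableSet_ball
    have h2 : Continuous fun z : ℝ × (Fin m → ℝ) => fun i => f i (z.2 + γ z.1) :=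
      continuous_pi fun i => (hfc i).comp (continuous_snd.add (hγc.comp continuous_fst))
    exact h1.imp (h2.measurable measurableSet_hasNoShortVectors)
  have hae : ∀ᵐ t : ℝ, ∀ᵐ y : Fin m → ℝ,
      y ∈ Metric.ball y₀ r → HasNoShortVectors fun i => f i (y + γ t) := by
    refine (Measure.ae_ae_comm (p := fun (t : ℝ) (y : Fin m → ℝ) =>
      y ∈ Metric.ball y₀ r → HasNoShortVectors fun i => f i (y + γ t)) hmeas).mpr
      (Filter.Eventually.of_forall fun y => ?_)
    by_cases hy : y ∈ Metric.ball y₀ r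
    · filter_upwards [hcurve y hy] with t ht _ using ht
    · exact Filter.Eventually.of_forall fun t h => absurd h hy
  obtain ⟨t, htr, ht⟩ := (Measure.dense_of_ae hae).inter_open_nonempty
    (γ ⁻¹' Metric.ball 0 (r / 2)) (Metric.isOpen_ball.preimage hγc)
    ⟨0, by simpa [hγ0] using half_pos hr⟩
  refine ⟨_, inter_mem_nhdsWithin _ (Metric.ball_mem_nhds y₀ (half_pos hr)), ?_⟩
  have hshift := (measurePreserving_sub_right (volume : Measure (Fin m → ℝ))
    (γ t)).quasiMeasurePreserving.ae ht
  refine measure_mono_null ?_ (ae_iff.mp hshift)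
  rintro z ⟨hz1, hz2⟩ h
  apply hz1
  rw [sub_add_cancel] at h
  refine h ?_
  have h3 : ‖γ t‖ < r / 2 := by simpa using htr
  rw [Metric.mem_ball, dist_eq_norm] at hz2 ⊢
  calc ‖z - γ t - y₀‖ = ‖(z - y₀) - γ t‖ := by congr 1; abel
    _ ≤ ‖z - y₀‖ + ‖γ t‖ := norm_sub_le _ _
    _ < r := by linarith

end CurveReduction

section Minkowski

open Matrix

theorem exists_intCast_mem_of_two_pow_lt_volume {L : ℕ} {K : Set (Fin L → ℝ)}
    (hsymm : ∀ x ∈ K, -x ∈ K) (hconv : Convex ℝ K) (hvol : 2 ^ L < volume K) :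
    ∃ v : Fin L → ℤ, v ≠ 0 ∧ (fun j => (v j : ℝ)) ∈ K := by
  have hfund := ZSpan.isAddFundamentalDomain (Pi.basisFun ℝ (Fin L)) volume
  have hF : volume (ZSpan.fundamentalDomain (Pi.basisFun ℝ (Fin L))) = 1 := by
    rw [ZSpan.fundamentalDomain_pi_basisFun, Real.volume_pi_Ico]
    simp
  have : Countable (Submodule.span ℤ (Set.range (Pi.basisFun ℝ (Fin L)))).toAddSubgroup :=
    inferInstanceAs (Countable (Submodule.span ℤ (Set.range (Pi.basisFun ℝ (Fin L)))))
  obtain ⟨⟨x, hxm⟩, hx0, hxK⟩ := exists_ne_zero_mem_lattice_of_measure_mul_two_pow_lt_measure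
    (L := (Submodule.span ℤ (Set.range (Pi.basisFun ℝ (Fin L)))).toAddSubgroup) hfund hsymm hconv
    (by rwa [hF, one_mul, Module.finrank_fin_fun])
  have hrepr := (Module.Basis.mem_span_iff_repr_mem ℤ (Pi.basisFun ℝ (Fin L)) x).mp hxm
  choose v hv using hrepr
  have hvx : (fun j => (v j : ℝ)) = x := funext fun j => by simpa using hv j
  refine ⟨v, fun h => hx0 ?_, hvx ▸ hxK⟩
  ext j
  simp [← hvx, h]

open scoped MatrixOrder in
/-- Minkowski's theorem for positive definite quadratic forms: if the form takes no value below one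
at nonzero integer vectors, then its determinant is bounded below. -/
theorem one_le_det_of_forall_one_le {L : ℕ} {M : Matrix (Fin L) (Fin L) ℝ} (hM : M.PosDef)
    (h : ∀ v : Fin L → ℤ, v ≠ 0 → 1 ≤ (fun j => (v j : ℝ)) ⬝ᵥ M *ᵥ fun j => (v j : ℝ)) :
    1 ≤ (L : ℝ) ^ (2 * L) * M.det := by
  rcases Nat.eq_zero_or_pos L with rfl | hL
  · simp
  obtain ⟨S, hS⟩ := CStarAlgebra.nonneg_iff_eq_star_mul_self.mp hM.posSemidef.nonneg
  rw [star_eq_conjTranspose, conjTranspose_eq_transpose_of_trivial] at hS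
  have hdet : M.det = S.det ^ 2 := by rw [hS, det_mul, det_transpose, sq]
  have hS0 : S.det ≠ 0 := by
    intro h0
    have := hM.det_pos
    rw [hdet, h0] at this
    simp at this
  have hL0 : (0 : ℝ) < L := by exact_mod_cast hL
  have hform : ∀ y, y ⬝ᵥ M *ᵥ y = (S *ᵥ y) ⬝ᵥ (S *ᵥ y) := by
    intro y
    rw [hS, ← mulVec_mulVec, mulVec_transpose, dotProduct_comm, ← dotProduct_mulVec]
  by_contra! hlt
  have habs : (L : ℝ) ^ L * |S.det| < 1 := by
    rw [← abs_of_pos (pow_pos hL0 L), ← abs_mul, ← sq_lt_one_iff_abs_lt_one]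
    calc ((L : ℝ) ^ L * S.det) ^ 2 = (L : ℝ) ^ (2 * L) * M.det := by rw [hdet]; ring
      _ < 1 := hlt
  have hvol : 2 ^ L < volume (S.mulVecLin ⁻¹' Metric.ball 0 (L : ℝ)⁻¹) := by
    have hld : LinearMap.det S.mulVecLin = S.det := by
      rw [← toLin'_apply', LinearMap.det_toLin']
    rw [Measure.addHaar_preimage_linearMap _ (by rwa [hld]), hld, Real.volume_pi_ball _ (by positivity),
      ← ENNReal.ofReal_mul (abs_nonneg _), Fintype.card_fin]
    rw [show (2 : ENNReal) ^ L = ENNReal.ofReal (2 ^ L) by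
      rw [ENNReal.ofReal_pow (by norm_num)]; simp]
    rw [ENNReal.ofReal_lt_ofReal_iff (by positivity), abs_inv, mul_pow, inv_pow]
    have h1 : 1 < |S.det|⁻¹ * ((L : ℝ) ^ L)⁻¹ := by
      rw [← mul_inv, mul_comm]
      exact (one_lt_inv₀ (by positivity)).mpr habs
    have h2 : (0 : ℝ) < 2 ^ L := by positivity
    nlinarith
  obtain ⟨v, hv0, hv⟩ := exists_intCast_mem_of_two_pow_lt_volume
    (fun x hx => by simpa [mulVec_neg] using hx) ((convex_ball _ _).linear_preimage S.mulVecLin) hvol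
  refine absurd (h v hv0) (not_le.mpr ?_)
  rw [hform]
  have hnorm : ‖S *ᵥ fun j => (v j : ℝ)‖ < (L : ℝ)⁻¹ := by simpa using hv
  have hterm : ∀ i, (S *ᵥ fun j => (v j : ℝ)) i * (S *ᵥ fun j => (v j : ℝ)) i < (L : ℝ)⁻¹ := by
    intro i
    have h1 := (norm_le_pi_norm (S *ᵥ fun j => (v j : ℝ)) i).trans_lt hnorm
    have h2 : (L : ℝ)⁻¹ ≤ 1 := inv_le_one_of_one_le₀ (by exact_mod_cast hL)
    rw [Real.norm_eq_abs] at h1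
    rw [← abs_mul_abs_self]
    nlinarith [abs_nonneg ((S *ᵥ fun j => (v j : ℝ)) i)]
  calc (S *ᵥ fun j => (v j : ℝ)) ⬝ᵥ (S *ᵥ fun j => (v j : ℝ)) < ∑ _i : Fin L, (L : ℝ)⁻¹ :=
        Finset.sum_lt_sum_of_nonempty ⟨⟨0, hL⟩, Finset.mem_univ _⟩ fun i _ => hterm i
    _ = 1 := by simp [hL0.ne']

/-- If the integer vectors of squared length at most `R` lie in a hyperplane, then the determinant
of the form is bounded below in terms of `R` and the minimum `lam` of the form. -/
theorem le_det_of_short_vectors_orthogonal {L : ℕ} {M : Matrix (Fin L) (Fin L) ℝ} (hM : M.PosDef)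
    {lam R : ℝ} (hlam : 0 < lam) (hR : lam ≤ R) {u : Fin L → ℝ} (hu : u ⬝ᵥ M *ᵥ u = 1)
    (hmin : ∀ v : Fin L → ℤ, v ≠ 0 → lam ≤ (fun j => (v j : ℝ)) ⬝ᵥ M *ᵥ fun j => (v j : ℝ))
    (hshort : ∀ v : Fin L → ℤ, (fun j => (v j : ℝ)) ⬝ᵥ M *ᵥ (fun j => (v j : ℝ)) ≤ R →
      (fun j => (v j : ℝ)) ⬝ᵥ M *ᵥ u = 0) :
    lam ^ L * R ≤ (L : ℝ) ^ (2 * L) * (lam * M.det) := by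
  have hR0 : 0 < R := hlam.trans_le hR
  have hMt : Mᵀ = M := by
    have := hM.isHermitian
    rwa [Matrix.IsHermitian, conjTranspose_eq_transpose_of_trivial] at this
  have hcomm : ∀ x y, x ⬝ᵥ M *ᵥ y = y ⬝ᵥ M *ᵥ x := fun x y => by
    rw [dotProduct_mulVec, ← mulVec_transpose, hMt, dotProduct_comm]
  set γ := lam⁻¹ - R⁻¹ with hγ
  have hγ0 : 0 ≤ γ := sub_nonneg.mpr (inv_anti₀ hlam hR)
  set M' := lam⁻¹ • M - γ • vecMulVec (M *ᵥ u) (M *ᵥ u) with hM'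
  have hform : ∀ y, y ⬝ᵥ M' *ᵥ y = lam⁻¹ * (y ⬝ᵥ M *ᵥ y) - γ * (y ⬝ᵥ M *ᵥ u) ^ 2 := by
    intro y
    simp only [hM', sub_mulVec, smul_mulVec, vecMulVec_mulVec, dotProduct_sub, dotProduct_smul,
      smul_eq_mul, op_smul_eq_smul, dotProduct_comm (M *ᵥ u) y]
    ring
  have hCS : ∀ y, (y ⬝ᵥ M *ᵥ u) ^ 2 ≤ y ⬝ᵥ M *ᵥ y := by
    intro y
    have h0 := hM.posSemidef.dotProduct_mulVec_nonneg (y - (y ⬝ᵥ M *ᵥ u) • u)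
    simp only [star_trivial, mulVec_sub, mulVec_smul, sub_dotProduct, dotProduct_sub,
      smul_dotProduct, dotProduct_smul, smul_eq_mul, hcomm u y, hu] at h0
    linarith
  have hlow : ∀ y, R⁻¹ * (y ⬝ᵥ M *ᵥ y) ≤ y ⬝ᵥ M' *ᵥ y := by
    intro y
    rw [hform]
    nlinarith [mul_le_mul_of_nonneg_left (hCS y) hγ0]
  have hpd : M'.PosDef := by
    apply PosDef.of_dotProduct_mulVec_pos
    · rw [Matrix.IsHermitian, conjTranspose_eq_transpose_of_trivial]
      simp [hM', transpose_sub, transpose_smul, transpose_vecMulVec, hMt]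
    · intro x hx
      rw [star_trivial]
      have := hM.dotProduct_mulVec_pos hx
      rw [star_trivial] at this
      exact (mul_pos (inv_pos.mpr hR0) this).trans_le (hlow x)
  have hdet : M'.det = lam⁻¹ ^ L * M.det * (lam * R⁻¹) := by
    have hfac : M' = (lam⁻¹ • M) *
        (1 + replicateCol Unit u * replicateRow Unit ((-(lam * γ)) • (M *ᵥ u))) := by
      rw [Matrix.mul_add, Matrix.mul_one, ← vecMulVec_eq, vecMulVec_smul, Matrix.mul_smul,
        Matrix.smul_mul, mul_vecMulVec, smul_smul, hM', sub_eq_add_neg, ← neg_smul]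
      congr 2
      field_simp
    rw [hfac, det_mul, det_smul, Fintype.card_fin, det_one_add_replicateCol_mul_replicateRow,
      smul_dotProduct, dotProduct_comm, hu, smul_eq_mul, hγ]
    field_simp
    ring
  have hone := one_le_det_of_forall_one_le hpd fun v hv => by
    by_cases hvR : (fun j => (v j : ℝ)) ⬝ᵥ M *ᵥ (fun j => (v j : ℝ)) ≤ R
    · rw [hform, hshort v hvR, ← inv_mul_cancel₀ hlam.ne']
      have := mul_le_mul_of_nonneg_left (hmin v hv) (inv_pos.mpr hlam).le
      linarith
    · refine le_trans ?_ (hlow _)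
      rw [← inv_mul_cancel₀ hR0.ne']
      exact mul_le_mul_of_nonneg_left (not_le.mp hvR).le (inv_pos.mpr hR0).le
  rw [hdet] at hone
  calc lam ^ L * R ≤ lam ^ L * R * ((L : ℝ) ^ (2 * L) * (lam⁻¹ ^ L * M.det * (lam * R⁻¹))) :=
        le_mul_of_one_le_right (by positivity) hone
    _ = (L : ℝ) ^ (2 * L) * (lam * M.det) := by
        rw [inv_pow]
        field_simp

/-- A positive definite form with large minimum has linearly independent integer vectors that are
not too long. -/
theorem exists_linearIndependent_short_vectors {L : ℕ} {M : Matrix (Fin L) (Fin L) ℝ}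
    (hM : M.PosDef) {lam R : ℝ} (hlam : 0 < lam) (hR : lam ≤ R)
    (hmin : ∀ v : Fin L → ℤ, v ≠ 0 → lam ≤ (fun j => (v j : ℝ)) ⬝ᵥ M *ᵥ fun j => (v j : ℝ))
    (hbig : (L : ℝ) ^ (2 * L) * (lam * M.det) < lam ^ L * R) :
    ∃ a : Fin L → Fin L → ℤ, LinearIndependent ℝ (fun i j => (a i j : ℝ)) ∧
      ∀ i, (fun j => (a i j : ℝ)) ⬝ᵥ M *ᵥ (fun j => (a i j : ℝ)) ≤ R := by
  set T : Set (Fin L → ℝ) := {x | ∃ v : Fin L → ℤ, (fun j => (v j : ℝ)) = x ∧ x ⬝ᵥ M *ᵥ x ≤ R}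
    with hT
  have htop : Submodule.span ℝ T = ⊤ := by
    by_contra hne
    obtain ⟨φ, hφ, hker⟩ := Submodule.exists_le_ker_of_lt_top _ (lt_top_iff_ne_top.mpr hne)
    obtain ⟨n, rfl⟩ := (dotProductEquiv ℝ (Fin L)).surjective φ
    have hn0 : n ≠ 0 := by
      rintro rfl
      exact hφ (map_zero _)
    set w := M⁻¹ *ᵥ n with hw
    have hMw : M *ᵥ w = n := by
      rw [hw, mulVec_mulVec, mul_nonsing_inv _ ((isUnit_iff_isUnit_det M).mp hM.isUnit), one_mulVec]
    have hw0 : w ≠ 0 := by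
      intro h0
      rw [h0, mulVec_zero] at hMw
      exact hn0 hMw.symm
    have hpos : 0 < w ⬝ᵥ M *ᵥ w := by simpa using hM.dotProduct_mulVec_pos hw0
    refine absurd hbig (not_lt.mpr (le_det_of_short_vectors_orthogonal hM hlam hR
      (u := (Real.sqrt (w ⬝ᵥ M *ᵥ w))⁻¹ • w) ?_ hmin fun v hv => ?_))
    · rw [mulVec_smul, smul_dotProduct, dotProduct_smul, smul_eq_mul, smul_eq_mul, ← mul_assoc,
        ← mul_inv, Real.mul_self_sqrt hpos.le, inv_mul_cancel₀ hpos.ne']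
    · have h0 : (fun j => (v j : ℝ)) ⬝ᵥ n = 0 :=
        (dotProduct_comm _ _).trans (hker (Submodule.subset_span ⟨v, rfl, hv⟩))
      rw [mulVec_smul, dotProduct_smul, hMw, h0, smul_zero]
  obtain ⟨x, hx, -, hli⟩ := Submodule.exists_fun_fin_finrank_span_eq ℝ T
  have hrank : Module.finrank ℝ (Submodule.span ℝ T) = L := by
    rw [htop, finrank_top, Module.finrank_fin_fun]
  choose a ha haR using hx
  refine ⟨fun i => a (Fin.cast hrank.symm i), ?_, fun i => ?_⟩
  · have hcomp := hli.comp _ (Fin.cast_injective hrank.symm)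
    rwa [show x ∘ Fin.cast hrank.symm = fun i j => (a (Fin.cast hrank.symm i) j : ℝ) from
      funext fun i => (ha _).symm] at hcomp
  · simp only [ha, haR]

end Minkowski

section SuccessiveMinima

open Matrix Filter

theorem dotProduct_channelMatrix_mono {L : ℕ} {s t : ℝ} (hst : s ≤ t) (g v : Fin L → ℝ) :
    v ⬝ᵥ channelMatrix s g *ᵥ v ≤ v ⬝ᵥ channelMatrix t g *ᵥ v := by
  simp only [dotProduct_channelMatrix_mulVec, dotProduct_comm g v]
  nlinarith [dotProduct_mul_self_le v g]

theorem det_channelMatrix {L : ℕ} {s : ℝ} (hL : 1 ≤ L) (hs : 0 ≤ s) (g : Fin L → ℝ) :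
    (channelMatrix s g).det = (1 + s * (g ⬝ᵥ g)) ^ (L - 1) := by
  have hgg : 0 ≤ g ⬝ᵥ g := by simpa using dotProduct_star_self_nonneg g
  set c := 1 + s * (g ⬝ᵥ g) with hc
  have hc0 : 0 < c := by positivity
  have hfac : channelMatrix s g =
      c • (1 + replicateCol Unit g * replicateRow Unit ((-(c⁻¹ * s)) • g)) := by
    rw [← vecMulVec_eq, vecMulVec_smul, smul_add, smul_smul, channelMatrix, ← hc, sub_eq_add_neg,
      ← neg_smul]
    congr 2
    field_simp
  rw [hfac, det_smul, Fintype.card_fin, det_one_add_replicateCol_mul_replicateRow, smul_dotProduct,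
    smul_eq_mul]
  obtain ⟨k, rfl⟩ : ∃ k, L = k + 1 := ⟨L - 1, by omega⟩
  have h1 : c * (1 + -(c⁻¹ * s) * (g ⬝ᵥ g)) = 1 := by
    field_simp
    rw [hc]
    ring
  rw [pow_succ, mul_assoc, h1, mul_one, Nat.add_sub_cancel]

theorem HasNoShortVectors.eventually_le {L : ℕ} (hL : 1 ≤ L) {g : Fin L → ℝ}
    (hg : HasNoShortVectors g) {ε : ℝ} (hε : 0 < ε) :
    ∀ᶠ s : ℝ in atTop, ∀ v : Fin L → ℤ, v ≠ 0 → s ^ (((L : ℝ) - 1) / L - ε) ≤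
      (fun j => (v j : ℝ)) ⬝ᵥ channelMatrix s g *ᵥ (fun j => (v j : ℝ)) := by
  obtain ⟨j, hj⟩ := exists_nat_one_div_lt hε
  set θ : ℝ := 1 / ((j : ℝ) + 1) with hθ
  have hθ0 : 0 < θ := by positivity
  obtain ⟨N, hN⟩ := eventually_atTop.mp (hg.2 j)
  have hL0 : (0 : ℝ) < L := by exact_mod_cast hL
  filter_upwards [eventually_ge_atTop 1, eventually_ge_atTop (((2 : ℝ) ^ (N + 1)) ^ L),
    (tendsto_rpow_atTop (sub_pos.mpr hj)).eventually_ge_atTop ((2 : ℝ) ^ (L - 1))]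
    with s hs1 hsN hsε v hv
  have hs0 : 0 < s := by linarith
  set t := s ^ (1 / (L : ℝ)) with ht
  have htL : t ^ L = s := by
    rw [ht, ← Real.rpow_natCast, ← Real.rpow_mul hs0.le, one_div_mul_cancel hL0.ne', Real.rpow_one]
  have ht1 : 1 ≤ t := Real.one_le_rpow hs1 (by positivity)
  have ht0 : 0 < t := by linarith
  have hts : t ≤ s := by
    rw [← htL]
    exact le_self_pow₀ ht1 (by omega)
  obtain ⟨n, hn1, hn2⟩ := exists_nat_pow_near ht1 (one_lt_two (α := ℝ))
  have hNn : N ≤ n := by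
    have h1 : (2 : ℝ) ^ (N + 1) ≤ t := by
      rw [← htL] at hsN
      exact le_of_pow_le_pow_left₀ (by omega) ht0.le hsN
    have h2 := (pow_lt_pow_iff_right₀ (one_lt_two (α := ℝ))).mp (h1.trans_lt hn2)
    omega
  have hform := hN n hNn v hv
  rw [le_inv_mul_iff₀ (by positivity)] at hform
  refine le_trans ?_ (hform.trans (dotProduct_channelMatrix_mono ?_ _ _))
  · have h1 : (t / 2) ^ (L - 1) ≤ ((2 : ℝ) ^ n) ^ (L - 1) := by
      refine pow_le_pow_left₀ (by positivity) ?_ _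
      rw [pow_succ] at hn2
      linarith
    have h2 : s ^ (-θ) ≤ ((2 : ℝ) ^ (-θ)) ^ n := by
      rw [← Real.rpow_natCast, ← Real.rpow_mul zero_le_two, mul_comm, Real.rpow_mul zero_le_two,
        Real.rpow_natCast]
      exact Real.rpow_le_rpow_of_nonpos (by positivity) (hn1.trans hts) (by linarith)
    have h3 : s ^ (((L : ℝ) - 1) / L) = t ^ (L - 1) := by
      rw [ht, ← Real.rpow_natCast, ← Real.rpow_mul hs0.le, Nat.cast_sub hL]
      congr 1
      push_cast
      ring
    have h4 : s ^ (-ε) * 2 ^ (L - 1) ≤ s ^ (-θ) := by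
      calc s ^ (-ε) * 2 ^ (L - 1) ≤ s ^ (-ε) * s ^ (ε - θ) := by gcongr
        _ = s ^ (-θ) := by rw [← Real.rpow_add hs0]; congr 1; ring
    calc s ^ (((L : ℝ) - 1) / L - ε) = t ^ (L - 1) * s ^ (-ε) := by
          rw [sub_eq_add_neg, Real.rpow_add hs0, h3]
      _ = (t / 2) ^ (L - 1) * (s ^ (-ε) * 2 ^ (L - 1)) := by rw [div_pow]; field_simp
      _ ≤ _ := by gcongr; exact h4.trans h2
  · rw [← htL]
    exact pow_le_pow_left₀ (by positivity) hn1 _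

theorem HasNoShortVectors.eventually_exists_linearIndependent {L : ℕ} (hL : 1 ≤ L)
    {g : Fin L → ℝ} (hg : HasNoShortVectors g) {ε : ℝ} (hε : 0 < ε) :
    ∀ᶠ s : ℝ in atTop, ∃ a : Fin L → Fin L → ℤ, LinearIndependent ℝ (fun i j => (a i j : ℝ)) ∧
      ∀ i, (fun j => (a i j : ℝ)) ⬝ᵥ channelMatrix s g *ᵥ (fun j => (a i j : ℝ)) ≤
        s ^ (((L : ℝ) - 1) / L + ε) := by
  have hL0 : (0 : ℝ) < L := by exact_mod_cast hL
  have hgg : 0 ≤ g ⬝ᵥ g := by simpa using dotProduct_star_self_nonneg g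
  have hδ : 0 < ε / L := by positivity
  filter_upwards [eventually_ge_atTop 1, hg.eventually_le hL hδ,
    (tendsto_rpow_atTop hδ).eventually_gt_atTop ((L : ℝ) ^ (2 * L) * (1 + g ⬝ᵥ g) ^ (L - 1))]
    with s hs1 hmin hsε
  have hs0 : 0 < s := by linarith
  refine exists_linearIndependent_short_vectors (posDef_channelMatrix hs0.le g)
    (Real.rpow_pos_of_pos hs0 _) (Real.rpow_le_rpow_of_exponent_le hs1 (by linarith)) hmin ?_
  rw [det_channelMatrix hL hs0.le]
  set lam := s ^ (((L : ℝ) - 1) / L - ε / L) with hlam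
  have hlam0 : 0 < lam := Real.rpow_pos_of_pos hs0 _
  have h1 : 1 + s * (g ⬝ᵥ g) ≤ s * (1 + g ⬝ᵥ g) := by linarith
  have h2 : lam ^ (L - 1) * s ^ (((L : ℝ) - 1) / L + ε) = s ^ (L - 1) * s ^ (ε / L) := by
    rw [hlam, ← Real.rpow_natCast, ← Real.rpow_natCast, ← Real.rpow_mul hs0.le,
      ← Real.rpow_add hs0, ← Real.rpow_add hs0, Nat.cast_sub hL]
    congr 1
    push_cast
    field_simp
    ring
  calc (L : ℝ) ^ (2 * L) * (lam * (1 + s * (g ⬝ᵥ g)) ^ (L - 1))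
      ≤ (L : ℝ) ^ (2 * L) * (lam * (s * (1 + g ⬝ᵥ g)) ^ (L - 1)) := by gcongr
    _ = lam * (s ^ (L - 1) * ((L : ℝ) ^ (2 * L) * (1 + g ⬝ᵥ g) ^ (L - 1))) := by
        rw [mul_pow]; ring
    _ < lam * (s ^ (L - 1) * s ^ (ε / L)) := by gcongr
    _ = lam ^ L * s ^ (((L : ℝ) - 1) / L + ε) := by
        rw [← h2, ← mul_assoc, ← pow_succ', Nat.sub_add_cancel hL]

end SuccessiveMinima

section Rates

open Matrix Filter

theorem sum_sq_sub_eq {L : ℕ} (g a : Fin L → ℝ) (β : ℝ) :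
    ∑ j, (β * g j - a j) ^ 2 = β ^ 2 * (g ⬝ᵥ g) - 2 * β * (a ⬝ᵥ g) + a ⬝ᵥ a := by
  simp only [dotProduct, Finset.mul_sum, ← Finset.sum_sub_distrib, ← Finset.sum_add_distrib]
  exact Finset.sum_congr rfl fun j _ => by ring

theorem le_iInf_effective_noise {L : ℕ} {s : ℝ} (hs : 0 < s) {b : Fin L → ℝ} (hb : ∀ j, 1 ≤ b j)
    (g a : Fin L → ℝ) :
    s * (a ⬝ᵥ channelMatrix s g *ᵥ a) / (1 + s * (g ⬝ᵥ g)) ≤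
      ⨅ β : ℝ, (s * (∑ j, b j * (β * g j - a j) ^ 2) + β ^ 2) := by
  have hgg : 0 ≤ g ⬝ᵥ g := by simpa using dotProduct_star_self_nonneg g
  refine le_ciInf fun β => ?_
  have h1 : ∑ j, (β * g j - a j) ^ 2 ≤ ∑ j, b j * (β * g j - a j) ^ 2 :=
    Finset.sum_le_sum fun j _ => le_mul_of_one_le_left (sq_nonneg _) (hb j)
  have h2 := mul_le_mul_of_nonneg_left h1 hs.le
  refine le_trans ?_ (add_le_add_left h2 (β ^ 2))
  rw [div_le_iff₀ (by positivity), sum_sq_sub_eq, dotProduct_channelMatrix_mulVec,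
    dotProduct_comm g a]
  nlinarith [sq_nonneg ((1 + s * (g ⬝ᵥ g)) * β - s * (a ⬝ᵥ g))]

theorem iInf_effective_noise_le {L : ℕ} {s : ℝ} (hs : 0 < s) {b : Fin L → ℝ} (hb : ∀ j, 1 ≤ b j)
    {B : ℝ} (hB : 1 ≤ B) (hbB : ∀ j, b j ≤ B) (g a : Fin L → ℝ) :
    ⨅ β : ℝ, (s * (∑ j, b j * (β * g j - a j) ^ 2) + β ^ 2) ≤
      B * (s * (a ⬝ᵥ channelMatrix s g *ᵥ a) / (1 + s * (g ⬝ᵥ g))) := by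
  have hgg : 0 ≤ g ⬝ᵥ g := by simpa using dotProduct_star_self_nonneg g
  have hc : 0 < 1 + s * (g ⬝ᵥ g) := by positivity
  set β := s * (a ⬝ᵥ g) / (1 + s * (g ⬝ᵥ g)) with hβ
  have hbdd : BddBelow (Set.range fun β : ℝ => s * (∑ j, b j * (β * g j - a j) ^ 2) + β ^ 2) := by
    refine ⟨0, ?_⟩
    rintro _ ⟨β, rfl⟩
    have : 0 ≤ ∑ j, b j * (β * g j - a j) ^ 2 :=
      Finset.sum_nonneg fun j _ => mul_nonneg (zero_le_one.trans (hb j)) (sq_nonneg _)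
    positivity
  refine (ciInf_le hbdd β).trans ?_
  have h1 : ∑ j, b j * (β * g j - a j) ^ 2 ≤ B * ∑ j, (β * g j - a j) ^ 2 := by
    rw [Finset.mul_sum]
    exact Finset.sum_le_sum fun j _ => mul_le_mul_of_nonneg_right (hbB j) (sq_nonneg _)
  have h2 : s * (a ⬝ᵥ channelMatrix s g *ᵥ a) / (1 + s * (g ⬝ᵥ g)) =
      s * ∑ j, (β * g j - a j) ^ 2 + β ^ 2 := by
    rw [sum_sq_sub_eq, dotProduct_channelMatrix_mulVec, dotProduct_comm g a, hβ]
    field_simp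
    ring
  rw [h2]
  have h3 := mul_le_mul_of_nonneg_left h1 hs.le
  nlinarith [mul_le_mul_of_nonneg_right hB (sq_nonneg β)]

/-- The rate of every nonzero coefficient vector is at most about `1 / L` of the capacity. -/
theorem HasNoShortVectors.eventually_rate_le {L : ℕ} (hL : 1 ≤ L) {g : Fin L → ℝ}
    (hg : HasNoShortVectors g) {b : Fin L → ℝ} (hb : ∀ j, 1 ≤ b j) {ε : ℝ} (hε : 0 < ε) :
    ∀ᶠ s : ℝ in atTop, ∀ a : Fin L → ℤ, a ≠ 0 →
      (1 / 2) * Real.logb 2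
        (s / ⨅ β : ℝ, (s * (∑ j, b j * (β * g j - (a j : ℝ)) ^ 2) + β ^ 2)) ≤
      (1 / (L : ℝ) + 2 * ε) * ((1 / 2) * Real.logb 2 s) := by
  have hL0 : (0 : ℝ) < L := by exact_mod_cast hL
  have hgg : 0 ≤ g ⬝ᵥ g := by simpa using dotProduct_star_self_nonneg g
  filter_upwards [eventually_ge_atTop 1, hg.eventually_le hL hε,
    (tendsto_rpow_atTop hε).eventually_ge_atTop (1 + g ⬝ᵥ g)] with s hs1 hmin hsε a ha
  have hs0 : 0 < s := by linarith
  have hN := le_iInf_effective_noise hs0 hb g fun j => (a j : ℝ)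
  set N := ⨅ β : ℝ, (s * (∑ j, b j * (β * g j - (a j : ℝ)) ^ 2) + β ^ 2) with hNdef
  set p := ((L : ℝ) - 1) / L - ε with hp
  have hsp : 0 < s ^ p := Real.rpow_pos_of_pos hs0 _
  have hc : 0 < 1 + s * (g ⬝ᵥ g) := by positivity
  have hcε : 1 + s * (g ⬝ᵥ g) ≤ s * s ^ ε := by nlinarith
  have hlow : s ^ (p - ε) ≤ N := by
    refine le_trans ?_ hN
    rw [le_div_iff₀ hc]
    calc s ^ (p - ε) * (1 + s * (g ⬝ᵥ g)) ≤ s ^ (p - ε) * (s * s ^ ε) := by gcongr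
      _ = s * s ^ p := by
          rw [mul_left_comm, ← Real.rpow_add hs0, sub_add_cancel]
      _ ≤ _ := mul_le_mul_of_nonneg_left (hmin a ha) hs0.le
  have hN0 : 0 < N := (Real.rpow_pos_of_pos hs0 _).trans_le hlow
  have hquot : s / N ≤ s ^ (1 / (L : ℝ) + 2 * ε) := by
    rw [div_le_iff₀ hN0]
    calc s = s ^ (1 / (L : ℝ) + 2 * ε) * s ^ (p - ε) := by
          rw [← Real.rpow_add hs0, show 1 / (L : ℝ) + 2 * ε + (p - ε) = 1 by
            rw [hp]; field_simp; ring, Real.rpow_one]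
      _ ≤ _ := by gcongr
  calc (1 / 2) * Real.logb 2 (s / N)
      ≤ (1 / 2) * Real.logb 2 (s ^ (1 / (L : ℝ) + 2 * ε)) := by
        gcongr
        exact one_lt_two
    _ = _ := by
        rw [Real.logb_rpow_eq_mul_logb_of_pos hs0]
        ring

/-- There are `L` linearly independent coefficient vectors whose rates are at least about `1 / L`
of the capacity. -/
theorem HasNoShortVectors.eventually_exists_le_rate {L : ℕ} (hL : 1 ≤ L) {g : Fin L → ℝ}
    (hg : HasNoShortVectors g) {b : Fin L → ℝ} (hb : ∀ j, 1 ≤ b j) {ε : ℝ} (hε : 0 < ε) :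
    ∀ᶠ s : ℝ in atTop, ∃ a : Fin L → Fin L → ℤ,
      LinearIndependent ℝ (fun i j => (a i j : ℝ)) ∧ ∀ i,
      (1 / (L : ℝ) - 2 * ε) * ((1 / 2) * Real.logb 2 s) ≤ (1 / 2) * Real.logb 2
        (s / ⨅ β : ℝ, (s * (∑ j, b j * (β * g j - (a i j : ℝ)) ^ 2) + β ^ 2)) := by
  have hL0 : (0 : ℝ) < L := by exact_mod_cast hL
  have hgg : 0 < g ⬝ᵥ g := by simpa using dotProduct_star_self_pos_iff.mpr hg.1
  have hB1 : 1 ≤ ∑ j, b j := (hb ⟨0, hL⟩).trans (Finset.single_le_sum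
    (fun j _ => zero_le_one.trans (hb j)) (Finset.mem_univ _))
  have hbB : ∀ j, b j ≤ ∑ j, b j := fun j => Finset.single_le_sum
    (fun j _ => zero_le_one.trans (hb j)) (Finset.mem_univ j)
  set B := ∑ j, b j with hB
  filter_upwards [eventually_ge_atTop 1, hg.eventually_exists_linearIndependent hL hε,
    (tendsto_rpow_atTop hε).eventually_ge_atTop (B / (g ⬝ᵥ g))] with s hs1 hs2 hsε
  obtain ⟨a, ha, hmax⟩ := hs2
  refine ⟨a, ha, fun i => ?_⟩
  have hs0 : 0 < s := by linarith
  have hNlow := le_iInf_effective_noise hs0 hb g fun j => (a i j : ℝ)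
  have hNup := iInf_effective_noise_le hs0 hb hB1 hbB g fun j => (a i j : ℝ)
  set N := ⨅ β : ℝ, (s * (∑ j, b j * (β * g j - (a i j : ℝ)) ^ 2) + β ^ 2) with hNdef
  set Q := (fun j => (a i j : ℝ)) ⬝ᵥ channelMatrix s g *ᵥ (fun j => (a i j : ℝ)) with hQ
  have hQ0 : 0 < Q := by
    simpa using (posDef_channelMatrix hs0.le g).dotProduct_mulVec_pos (ha.ne_zero i)
  have hc : 0 < 1 + s * (g ⬝ᵥ g) := by positivity
  have hN0 : 0 < N := lt_of_lt_of_le (by positivity) hNlow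
  set p := ((L : ℝ) - 1) / L + ε with hp
  have hup : N ≤ s ^ (p + ε) := by
    rw [div_le_iff₀ hgg] at hsε
    calc N ≤ B * (s * Q / (1 + s * (g ⬝ᵥ g))) := hNup
      _ = B * s * Q / (1 + s * (g ⬝ᵥ g)) := by ring
      _ ≤ s ^ ε * Q := by
          rw [div_le_iff₀ hc]
          have h1 : B * s ≤ s ^ ε * (1 + s * (g ⬝ᵥ g)) := by
            nlinarith [Real.rpow_pos_of_pos hs0 ε]
          nlinarith
      _ ≤ s ^ ε * s ^ p := by gcongr; exact hmax i
      _ = s ^ (p + ε) := by rw [← Real.rpow_add hs0, add_comm]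
  have hquot : s ^ (1 / (L : ℝ) - 2 * ε) ≤ s / N := by
    rw [le_div_iff₀ hN0]
    calc s ^ (1 / (L : ℝ) - 2 * ε) * N ≤ s ^ (1 / (L : ℝ) - 2 * ε) * s ^ (p + ε) := by gcongr
      _ = s := by
          rw [← Real.rpow_add hs0, show 1 / (L : ℝ) - 2 * ε + (p + ε) = 1 by
            rw [hp]; field_simp; ring, Real.rpow_one]
  calc (1 / (L : ℝ) - 2 * ε) * ((1 / 2) * Real.logb 2 s)
      = (1 / 2) * Real.logb 2 (s ^ (1 / (L : ℝ) - 2 * ε)) := by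
        rw [Real.logb_rpow_eq_mul_logb_of_pos hs0]
        ring
    _ ≤ _ := by
        gcongr
        exact one_lt_two

theorem tendsto_logb_div_logb_one_add :
    Tendsto (fun s : ℝ => ((1 / 2) * Real.logb 2 s) / ((1 / 2) * Real.logb 2 (1 + s)))
      atTop (nhds 1) := by
  have h1 : Tendsto (fun s : ℝ => Real.log (1 + s)) atTop atTop :=
    Real.tendsto_log_atTop.comp (tendsto_atTop_add_const_left _ _ tendsto_id)
  have h2 : Tendsto (fun s : ℝ => Real.log 2 / Real.log (1 + s)) atTop (nhds 0) :=
    tendsto_const_nhds.div_atTop h1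
  have h3 : Tendsto (fun s : ℝ => 1 - Real.log 2 / Real.log (1 + s)) atTop (nhds 1) := by
    simpa using tendsto_const_nhds.sub h2
  refine tendsto_of_tendsto_of_tendsto_of_le_of_le' h3 tendsto_const_nhds ?_ ?_
  all_goals
    filter_upwards [eventually_ge_atTop 1] with s hs
    have hlog : 0 < Real.log (1 + s) := Real.log_pos (by linarith)
    have h2 : 0 < Real.log 2 := Real.log_pos one_lt_two
    have heq : (1 / 2) * Real.logb 2 s / ((1 / 2) * Real.logb 2 (1 + s)) =
        Real.log s / Real.log (1 + s) := by
      rw [Real.logb, Real.logb]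
      field_simp
    rw [heq]
  · rw [sub_le_iff_le_add, ← add_div, one_le_div hlog, ← Real.log_mul (by linarith) two_ne_zero]
    exact Real.log_le_log (by linarith) (by linarith)
  · rw [div_le_one hlog]
    exact Real.log_le_log (by linarith) (by linarith)

/-- At points without short integer vectors, every optimal computation rate has `1 / L` degrees of
freedom. -/
theorem HasNoShortVectors.tendsto_rate {L : ℕ} (hL : 1 ≤ L) {g : Fin L → ℝ}
    (hg : HasNoShortVectors g) {b : Fin L → ℝ} (hb : ∀ j, 1 ≤ b j) {ℓ : ℕ} (hℓ : 1 ≤ ℓ)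
    (hℓL : ℓ ≤ L) :
    Tendsto (fun s : ℝ =>
      (⨆ a : {a : Fin ℓ → Fin L → ℤ // LinearIndependent ℝ (fun i => fun j => ((a i j : ℝ)))},
        ⨅ i : Fin ℓ, (1 / 2) * Real.logb 2
          (s / ⨅ β : ℝ, (s * (∑ j, b j * (β * g j - (a.1 i j : ℝ)) ^ 2) + β ^ 2))) /
        ((1 / 2) * Real.logb 2 (1 + s))) atTop (nhds (1 / (L : ℝ))) := by
  have : Nonempty (Fin ℓ) := ⟨⟨0, hℓ⟩⟩
  set rate : ℝ → (Fin L → ℤ) → ℝ := fun s a => (1 / 2) * Real.logb 2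
    (s / ⨅ β : ℝ, (s * (∑ j, b j * (β * g j - (a j : ℝ)) ^ 2) + β ^ 2)) with hrate
  set opt : ℝ → ℝ := fun s =>
    ⨆ a : {a : Fin ℓ → Fin L → ℤ // LinearIndependent ℝ (fun i => fun j => ((a i j : ℝ)))},
      ⨅ i : Fin ℓ, rate s (a.1 i) with hopt
  have hbounds : ∀ ε > 0, ∀ᶠ s : ℝ in atTop,
      (1 / (L : ℝ) - 2 * ε) * ((1 / 2) * Real.logb 2 s) ≤ opt s ∧
        opt s ≤ (1 / (L : ℝ) + 2 * ε) * ((1 / 2) * Real.logb 2 s) := by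
    intro ε hε
    filter_upwards [hg.eventually_rate_le hL hb hε, hg.eventually_exists_le_rate hL hb hε]
      with s hup hlow
    obtain ⟨a, ha, har⟩ := hlow
    let a' : {a : Fin ℓ → Fin L → ℤ // LinearIndependent ℝ (fun i => fun j => ((a i j : ℝ)))} :=
      ⟨fun i => a (Fin.castLE hℓL i), ha.comp _ (Fin.castLE_injective hℓL)⟩
    have hle : ∀ a : {a : Fin ℓ → Fin L → ℤ //
        LinearIndependent ℝ (fun i => fun j => ((a i j : ℝ)))},
        ⨅ i : Fin ℓ, rate s (a.1 i) ≤ (1 / (L : ℝ) + 2 * ε) * ((1 / 2) * Real.logb 2 s) := by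
      intro a
      refine (ciInf_le (Set.finite_range _).bddBelow ⟨0, hℓ⟩).trans (hup _ fun h0 => ?_)
      refine a.2.ne_zero ⟨0, hℓ⟩ (funext fun j => ?_)
      simp [h0]
    have : Nonempty {a : Fin ℓ → Fin L → ℤ //
        LinearIndependent ℝ (fun i => fun j => ((a i j : ℝ)))} := ⟨a'⟩
    refine ⟨?_, ciSup_le hle⟩
    refine le_trans ?_ (le_ciSup (f := fun a : {a : Fin ℓ → Fin L → ℤ //
      LinearIndependent ℝ (fun i => fun j => ((a i j : ℝ)))} => ⨅ i : Fin ℓ, rate s (a.1 i))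
      ⟨_, Set.forall_mem_range.mpr hle⟩ a')
    exact le_ciInf fun i => har _
  have hratio : Tendsto (fun s => opt s / ((1 / 2) * Real.logb 2 s)) atTop
      (nhds (1 / (L : ℝ))) := by
    rw [Metric.tendsto_nhds]
    intro ε hε
    filter_upwards [hbounds (ε / 4) (by positivity), eventually_gt_atTop 1] with s hs hs1
    have hlog : 0 < (1 / 2) * Real.logb 2 s := mul_pos one_half_pos (Real.logb_pos one_lt_two hs1)
    rw [← le_div_iff₀ hlog, ← div_le_iff₀ hlog] at hs
    rw [Real.dist_eq, abs_lt]
    constructor <;> linarith [hs.1, hs.2]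
  have hmul := hratio.mul tendsto_logb_div_logb_one_add
  rw [mul_one] at hmul
  refine hmul.congr' ?_
  filter_upwards [eventually_gt_atTop 1] with s hs1
  exact div_mul_div_cancel₀ (mul_pos one_half_pos (Real.logb_pos one_lt_two hs1)).ne'

end Rates

/-- Let `f₁,…,f_L : ℝ^m → ℝ` be real analytic and, together with the constant function
`1`, linearly independent over `ℝ`, and let `b_ℓ² ≥ 1` be effective weights. Then for
Lebesgue-almost every parameter `g̃ ∈ ℝ^m`, the effective channel vector
`g = (f₁(g̃),…,f_L(g̃))` is such that each of the `L` optimal weighted computation rates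
has degrees-of-freedom exactly `1/L`. -/
theorem stmt19 (m L : ℕ) (hm : 1 ≤ m) (hL : 1 ≤ L)
    (f : Fin L → ((Fin m → ℝ) → ℝ))
    (hanalytic : ∀ k, AnalyticOnNhd ℝ (f k) Set.univ)
    (hindep : LinearIndependent ℝ
      (Fin.cons (fun _ => (1 : ℝ)) f : Fin (L + 1) → (Fin m → ℝ) → ℝ))
    (b : Fin L → ℝ) (hb : ∀ ℓ, 1 ≤ b ℓ) :
    ∀ᵐ gtil : Fin m → ℝ ∂volume,
      ∀ ℓ0 : ℕ, 1 ≤ ℓ0 → ℓ0 ≤ L →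
        Filter.Tendsto (fun SNR : ℝ =>
            (⨆ a : {a : Fin ℓ0 → Fin L → ℤ //
                LinearIndependent ℝ (fun i => fun j => ((a i j : ℝ)))},
              ⨅ i : Fin ℓ0,
                (1 / 2 : ℝ) * Real.logb 2 (SNR /
                  (⨅ β : ℝ, SNR * (∑ j, b j * (β * f j gtil - (a.1 i j : ℝ)) ^ 2)
                    + β ^ 2)))
              / ((1 / 2 : ℝ) * Real.logb 2 (1 + SNR)))
          Filter.atTop (nhds (1 / L)) := by
  have hli : LinearIndependent ℝ f := by
    simpa [Function.comp_def] using hindep.comp Fin.succ (Fin.succ_injective L)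
  filter_upwards [ae_hasNoShortVectors hL f hanalytic hli] with y hy ℓ0 h1 h2
  exact hy.tendsto_rate hL hb h1 h2
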